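/- Let E be a non-vanishing extended multi-segment datum whose order satisfies (P′), and suppose that the partial dual dual_k^+ is applicable on E. Then dual_k^+(E) is a non-vanishing extended multi-segment datum on which dual_k^− is applicable, and dual_k^−(dual_k^+(E)) = E; in particular dual_k ∘ dual_k = id on the data where it is applicable. (The final assertions of Theorem 6.8 of the paper.) -/

import Mathlib

/-!
Common combinatorial setting for extended multi-segments (Moeglin-Atobe theory),
following Hazeltine-Liu-Lo, "On the intersection of local Arthur packets".
Rows of symbols are 0-indexed; row labels of labeled symbols are natural numbers.
-/

namespace LocalArthur

/-- A row `([A,B], l, eta)` of a symbol (an extended segment with the bound on `l` dropped). -/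
structure Row where
  A : ℚ
  B : ℚ
  l : ℚ
  eta : ℤ
deriving DecidableEq

/-- `a = A + B + 1`. -/
def Row.a (r : Row) : ℚ := r.A + r.B + 1

/-- `b = A - B + 1`. -/
def Row.b (r : Row) : ℚ := r.A - r.B + 1

/-- A rational number is an integer. -/
def IsInt (x : ℚ) : Prop := x.den = 1

instance (x : ℚ) : Decidable (IsInt x) := by unfold IsInt; infer_instance

/-- `(-1)^x` for an integer-valued rational `x` (junk value on non-integers). -/
def m1pow (x : ℚ) : ℤ := if x.num % 2 = 0 then 1 else -1

/-- Validity of a single row: `2A, 2B ∈ ℤ`, `A - B ∈ ℕ`, `l ∈ ℤ`, `eta = ±1`. -/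
def Row.IsES (r : Row) : Prop :=
  IsInt (2 * r.A) ∧ IsInt (2 * r.B) ∧ (∃ n : ℕ, r.A - r.B = (n : ℚ)) ∧
    IsInt r.l ∧ (r.eta = 1 ∨ r.eta = -1)

/-- The segment `[A,B]` of `r` is contained in that of `s`. -/
def Row.subseg (r s : Row) : Prop := s.B ≤ r.B ∧ r.A ≤ s.A

instance (r s : Row) : Decidable (r.subseg s) := by unfold Row.subseg; infer_instance

/-- A symbol: valid rows, `A_i + B_i ≥ 0`, all `A_i` congruent mod `ℤ`, and the
listed order admissible, i.e. condition (P). -/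
def IsSymbol (E : List Row) : Prop :=
  (∀ r ∈ E, r.IsES) ∧ (∀ r ∈ E, 0 ≤ r.A + r.B) ∧
    (∀ r ∈ E, ∀ s ∈ E, IsInt (r.A - s.A)) ∧
    E.Pairwise (fun r s => ¬ (s.A < r.A ∧ s.B < r.B))

/-- An extended multi-segment datum: a symbol with `0 ≤ l_i ≤ b_i / 2`. -/
def IsEMS (E : List Row) : Prop :=
  IsSymbol E ∧ ∀ r ∈ E, 0 ≤ r.l ∧ r.l ≤ r.b / 2

/-- The listed order satisfies (P'). -/
def Pprime (E : List Row) : Prop := E.Pairwise (fun r s => r.B ≤ s.B)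

/-- Equivalence of extended segments. -/
def Row.Equiv (r s : Row) : Prop :=
  r.A = s.A ∧ r.B = s.B ∧ r.l = s.l ∧ (r.eta = s.eta ∨ r.l = r.b / 2)

/-- Rowwise equivalence of symbols. -/
def SymEquiv (E F : List Row) : Prop := List.Forall₂ Row.Equiv E F

/-- Shift of one row: `[A,B] ↦ [A+d, B+d]`. -/
def Row.sh (r : Row) (d : ℤ) : Row := { r with A := r.A + d, B := r.B + d }

/-- Add on one row: `([A,B],l) ↦ ([A+d, B-d], l+d)`. -/
def Row.addOp (r : Row) (d : ℤ) : Row :=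
  { r with A := r.A + d, B := r.B - d, l := r.l + d }

/-- `sh^d` applied to every row. -/
def shAll (d : ℤ) (E : List Row) : List Row := E.map fun r => r.sh d

/-- The updated pair of rows in a row exchange of rows `r = row k` and `s = row k+1`
(assuming one of the segments contains the other); the first component is the new row
at position `k` (the updated `s`) and the second the new row at position `k+1`
(the updated `r`). -/
def rexPair (r s : Row) : Row × Row :=
  if r.subseg s then
    -- Case `[A_k,B_k] ⊆ [A_{k+1},B_{k+1}]`
    (if m1pow (r.A - r.B) * r.eta * s.eta = 1 then
        if s.b - 2 * s.l < 2 * (r.b - 2 * r.l) then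
          (⟨s.A, s.B, s.b - (s.l + (r.b - 2 * r.l)), m1pow (r.A - r.B) * s.eta⟩ : Row)
        else ⟨s.A, s.B, s.l + (r.b - 2 * r.l), m1pow (r.A - r.B + 1) * s.eta⟩
      else ⟨s.A, s.B, s.l - (r.b - 2 * r.l), m1pow (r.A - r.B + 1) * s.eta⟩,
     ⟨r.A, r.B, r.l, m1pow (s.A - s.B) * r.eta⟩)
  else
    -- Case `[A_{k+1},B_{k+1}] ⊊ [A_k,B_k]`
    (⟨s.A, s.B, s.l, m1pow (r.A - r.B) * s.eta⟩,
     if m1pow (r.A - r.B) * r.eta * s.eta = 1 then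
        if r.b - 2 * r.l < 2 * (s.b - 2 * s.l) then
          (⟨r.A, r.B, r.b - (r.l + (s.b - 2 * s.l)), m1pow (s.A - s.B) * r.eta⟩ : Row)
        else ⟨r.A, r.B, r.l + (s.b - 2 * s.l), m1pow (s.A - s.B + 1) * r.eta⟩
      else ⟨r.A, r.B, r.l - (s.b - 2 * s.l), m1pow (s.A - s.B + 1) * r.eta⟩)

/-- Row exchange `R_k` at positions `k, k+1` (0-indexed). -/
def rex (k : ℕ) (E : List Row) : List Row :=
  match E[k]?, E[k+1]? with
  | some r, some s =>
      if r.subseg s ∨ s.subseg r then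
        E.take k ++ (rexPair r s).1 :: (rexPair r s).2 :: E.drop (k + 2)
      else E
  | _, _ => E

/-- One row exchange step. -/
def ReorderStep (E F : List Row) : Prop := ∃ k, F = rex k E

/-- Admissible reorderings: finite sequences of row exchanges. -/
def Reorder : List Row → List Row → Prop := Relation.ReflTransGen ReorderStep

/-- Coincidence up to row exchanges (in either direction) and rowwise equivalence. -/
def UpToRex (E F : List Row) : Prop :=
  ∃ G, Relation.ReflTransGen (fun X Y => ReorderStep X Y ∨ ReorderStep Y X) E G ∧
    SymEquiv G F

/-- `α_i = ∑_{j<i} (A_j + B_j + 1)`. -/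
def alphaAt (E : List Row) (i : ℕ) : ℚ := ((E.take i).map Row.a).sum

/-- `β_i = ∑_{j>i} (A_j - B_j + 1)`. -/
def betaAt (E : List Row) (i : ℕ) : ℚ := ((E.drop (i + 1)).map Row.b).sum

/-- `γ_i = ∑_{j>i} (A_j + B_j + 1)`. -/
def gammaAt (E : List Row) (i : ℕ) : ℚ := ((E.drop (i + 1)).map Row.a).sum

/-- Condition (∗) of the non-vanishing criterion. -/
def StarCond (E : List Row) : Prop :=
  ∀ i : ℕ, ∀ r : Row, E[i]? = some r →
    (IsInt r.B → 0 ≤ r.B + r.l) ∧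
    (¬ IsInt r.B → r.eta = - m1pow (alphaAt E i) → (1 / 2 : ℚ) ≤ r.B + r.l) ∧
    (¬ IsInt r.B → r.eta = m1pow (alphaAt E i) → -(1 / 2 : ℚ) ≤ r.B + r.l)

/-- Xu's non-vanishing conditions at an adjacent pair of rows `(r, s) = (row k, row k+1)`. -/
def XuPair (r s : Row) : Prop :=
  ((r.A ≤ s.A ∧ r.B ≤ s.B) →
    (m1pow (r.A - r.B) * r.eta * s.eta = 1 →
        r.B + r.l ≤ s.B + s.l ∧ r.A - r.l ≤ s.A - s.l) ∧
    (m1pow (r.A - r.B) * r.eta * s.eta = -1 → r.A - r.l < s.B + s.l)) ∧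
  ((r.subseg s ∧ ¬ s.subseg r) →
    (m1pow (r.A - r.B) * r.eta * s.eta = 1 → 0 ≤ s.l - r.l ∧ s.l - r.l ≤ s.b - r.b) ∧
    (m1pow (r.A - r.B) * r.eta * s.eta = -1 → r.b ≤ r.l + s.l)) ∧
  ((s.subseg r ∧ ¬ r.subseg s) →
    (m1pow (r.A - r.B) * r.eta * s.eta = 1 → 0 ≤ r.l - s.l ∧ r.l - s.l ≤ r.b - s.b) ∧
    (m1pow (r.A - r.B) * r.eta * s.eta = -1 → s.b ≤ r.l + s.l))

/-- Xu's non-vanishing conditions at every adjacent pair of rows. -/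
def XuAll (E : List Row) : Prop := E.Chain' XuPair

/-- The non-vanishing criterion for an extended multi-segment datum. -/
def NonVanishing (E : List Row) : Prop :=
  StarCond E ∧
    ∀ d : ℕ, (∀ r ∈ E, 0 ≤ r.B + (d : ℚ)) →
      ∀ F, Reorder (shAll d E) F → XuAll F

/-- Applicability of a union-intersection at an adjacent pair of rows. -/
def uiApplicablePair (r s : Row) : Prop :=
  r.A < s.A ∧ r.B < s.B ∧
    ((m1pow (r.A - r.B) * r.eta * s.eta = 1 ∧
        (s.A - s.l = r.A - r.l ∨ s.B + s.l = r.B + r.l)) ∨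
      (m1pow (r.A - r.B) * r.eta * s.eta = -1 ∧ s.B + s.l = r.A - r.l + 1))

instance (r s : Row) : Decidable (uiApplicablePair r s) := by
  unfold uiApplicablePair; infer_instance

/-- Type 3' of a union-intersection at an adjacent pair. -/
def uiT3 (r s : Row) : Prop :=
  r.l = 0 ∧ s.l = 0 ∧ m1pow (r.A - r.B) * r.eta * s.eta = -1

instance (r s : Row) : Decidable (uiT3 r s) := by unfold uiT3; infer_instance

/-- The pair of rows produced by a union-intersection at an adjacent applicable pair. -/
def uiPair (r s : Row) : Row × Row :=
  if m1pow (r.A - r.B) * r.eta * s.eta = 1 then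
    if s.A - s.l = r.A - r.l then
      -- Case 1
      ((⟨s.A, r.B, r.l, r.eta⟩ : Row),
       (⟨r.A, s.B, s.l - (s.A - r.A), m1pow (s.A - r.A) * s.eta⟩ : Row))
    else
      -- Case 2
      if s.A - r.A ≤ r.b - 2 * r.l then
        (⟨s.A, r.B, r.l + (s.A - r.A), r.eta⟩,
         ⟨r.A, s.B, s.l, m1pow (s.A - r.A) * s.eta⟩)
      else
        (⟨s.A, r.B, r.b - r.l, - r.eta⟩,
         ⟨r.A, s.B, s.l, m1pow (s.A - r.A) * s.eta⟩)
  else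
    -- Case 3
    if s.l ≤ r.l then
      (⟨s.A, r.B, r.l, r.eta⟩, ⟨r.A, s.B, s.l, m1pow (s.A - r.A) * s.eta⟩)
    else
      (⟨s.A, r.B, r.l, r.eta⟩, ⟨r.A, s.B, r.l, m1pow (s.A - r.A + 1) * s.eta⟩)

/-- Union-intersection at positions `k, k+1` (deleting the second new row in type 3'). -/
def uiAt (k : ℕ) (E : List Row) : List Row :=
  match E[k]?, E[k+1]? with
  | some r, some s =>
      if uiApplicablePair r s then
        if uiT3 r s then
          E.take k ++ (uiPair r s).1 :: E.drop (k + 2)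
        else
          E.take k ++ (uiPair r s).1 :: (uiPair r s).2 :: E.drop (k + 2)
      else E
  | _, _ => E

/-- Minimality: no union-intersection is applicable. -/
def MinimalP (E : List Row) : Prop :=
  ∀ F, Reorder E F → ∀ k r s, F[k]? = some r → F[k+1]? = some s →
    ¬ uiApplicablePair r s

/-- The image of a row under Atobe's dual. -/
def dualRow (E : List Row) (i : ℕ) (r : Row) : Row :=
  let α := alphaAt E i
  let β := betaAt E i
  let η₀ : ℤ := if ¬ IsInt r.B ∧ r.l = r.b / 2 then - m1pow α else r.eta
  if IsInt r.B then
    ⟨r.A, -r.B, r.l + r.B, m1pow (α + β) * η₀⟩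
  else
    ⟨r.A, -r.B, r.l + r.B + ((m1pow α * η₀ : ℤ) : ℚ) / 2, - (m1pow (α + β) * η₀)⟩

/-- Atobe's dual of a symbol whose order satisfies (P'). -/
def dual (E : List Row) : List Row :=
  (E.mapIdx fun i r => dualRow E i r).reverse

/-- Applicability of the partial dual `dual_k^+` at position `k` (0-indexed). -/
def DualPlusApplicable (E : List Row) (k : ℕ) : Prop :=
  ∃ r, E[k]? = some r ∧ r.B = 1 / 2 ∧ r.l = 0 ∧ r.eta = - m1pow (alphaAt E k) ∧
    ∀ i, i < k → ∀ s, E[i]? = some s → s.B < 1 / 2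

/-- The partial dual `dual_k^+` at position `k`. -/
def dualPlus (k : ℕ) (E : List Row) : List Row :=
  match E[k]? with
  | some rk =>
      (dual ((dual E).set (E.length - 1 - k)
          ⟨rk.A, 1 / 2, 0, - m1pow (gammaAt E k)⟩)).take k ++
        (⟨rk.A, -(1 / 2), 0, - rk.eta⟩ : Row) :: E.drop (k + 1)
  | none => E

/-- Applicability of the partial dual `dual_k^-`. -/
def DualMinusApplicable (E : List Row) (k : ℕ) : Prop :=
  DualPlusApplicable (dual E) (E.length - 1 - k)

/-- The partial dual `dual_k^-`. -/
def dualMinus (k : ℕ) (E : List Row) : List Row :=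
  dual (dualPlus (E.length - 1 - k) (dual E))

/-- Maximality: `E` is not, up to row exchanges, the result of a union-intersection
applied to a non-vanishing extended multi-segment datum. -/
def Maximal (E : List Row) : Prop :=
  ¬ ∃ (E'' F : List Row) (k : ℕ) (r s : Row), IsEMS E'' ∧ NonVanishing E'' ∧
      Reorder E'' F ∧ F[k]? = some r ∧ F[k+1]? = some s ∧ uiApplicablePair r s ∧
      UpToRex (uiAt k F) E

/-- Absolute maximality. -/
def AbsolutelyMaximal (E : List Row) : Prop := Maximal E ∧ MinimalP (dual E)

/-- The sign `(-1)^{⌊b/2⌋ + l} * eta^b` of a row. -/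
def rowSign (r : Row) : ℤ :=
  (if (⌊r.b / 2⌋ + ⌊r.l⌋) % 2 = 0 then (1 : ℤ) else -1) * r.eta ^ (⌊r.b⌋.toNat)

/-- The sign product of a symbol. -/
def signProd (E : List Row) : ℤ := (E.map rowSign).prod

/-! ### Labeled symbols: rows carry labels that travel with them under reorderings. -/

/-- A labeled row. -/
abbrev LRow := ℕ × Row

/-- The underlying list of rows of a labeled symbol. -/
def rows (L : List LRow) : List Row := L.map Prod.snd

/-- `sh_i^d`, acting on the row labeled `i`. -/
def shL (i : ℕ) (d : ℤ) (L : List LRow) : List LRow :=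
  L.map fun p => if p.1 = i then (p.1, p.2.sh d) else p

/-- `add_i^d`, acting on the row labeled `i`. -/
def addL (i : ℕ) (d : ℤ) (L : List LRow) : List LRow :=
  L.map fun p => if p.1 = i then (p.1, p.2.addOp d) else p

/-- `sh^d` on a labeled symbol. -/
def shAllL (d : ℤ) (L : List LRow) : List LRow := L.map fun p => (p.1, p.2.sh d)

/-- Row exchange at positions `k, k+1` on a labeled symbol. -/
def rexL (k : ℕ) (L : List LRow) : List LRow :=
  match L[k]?, L[k+1]? with
  | some (a, r), some (c, s) =>
      if r.subseg s ∨ s.subseg r then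
        L.take k ++ (c, (rexPair r s).1) :: (a, (rexPair r s).2) :: L.drop (k + 2)
      else L
  | _, _ => L

/-- One row exchange step on labeled symbols. -/
def ReorderStepL (L M : List LRow) : Prop := ∃ k, M = rexL k L

/-- Admissible reorderings of labeled symbols. -/
def ReorderL : List LRow → List LRow → Prop := Relation.ReflTransGen ReorderStepL

/-- Labelwise equivalence of labeled symbols. -/
def LSymEquiv (L M : List LRow) : Prop :=
  List.Forall₂ (fun p q => p.1 = q.1 ∧ Row.Equiv p.2 q.2) L M

/-- `M` coincides with `L` up to row exchanges and rowwise equivalence (labels forgotten). -/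
def CoincidesUpToRex (L M : List LRow) : Prop :=
  ∃ L', Relation.ReflTransGen (fun X Y => ReorderStepL X Y ∨ ReorderStepL Y X) L L' ∧
    SymEquiv (rows L') (rows M)

/-- Union-intersection at positions `k, k+1` on a labeled symbol. -/
def uiAtL (k : ℕ) (L : List LRow) : List LRow :=
  match L[k]?, L[k+1]? with
  | some (a, r), some (c, s) =>
      if uiApplicablePair r s then
        if uiT3 r s then
          L.take k ++ (a, (uiPair r s).1) :: L.drop (k + 2)
        else
          L.take k ++ (a, (uiPair r s).1) :: (c, (uiPair r s).2) :: L.drop (k + 2)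
      else L
  | _, _ => L

/-- The relation `M = ui_{i,j}(L)`, with a constraint `P` on the adjacent pair used:
some admissible reordering `L'` of `L` puts the row labeled `i` immediately before the
row labeled `j`, `ui` is applicable there, and `M` is obtained from the result by row
exchanges restoring the original relative order of the (surviving) labels. -/
def UIrelWith (P : Row → Row → Prop) (L : List LRow) (i j : ℕ) (M : List LRow) : Prop :=
  ∃ (L' : List LRow) (k : ℕ) (r s : Row),
    ReorderL L L' ∧ L'[k]? = some (i, r) ∧ L'[k+1]? = some (j, s) ∧
    uiApplicablePair r s ∧ P r s ∧
    ReorderL (uiAtL k L') M ∧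
    M.map Prod.fst =
      (L.map Prod.fst).filter fun x => decide (x ∈ (uiAtL k L').map Prod.fst)

/-- The relation `M = ui_{i,j}(L)`. -/
def UIrel (L : List LRow) (i j : ℕ) (M : List LRow) : Prop :=
  UIrelWith (fun _ _ => True) L i j M

/-- Atobe's dual of a labeled symbol. -/
def dualL (L : List LRow) : List LRow :=
  (L.mapIdx fun i p => (p.1, dualRow (rows L) i p.2)).reverse

/-- The partial dual `dual^+` at position `k` on a labeled symbol. -/
def dualPlusL (k : ℕ) (L : List LRow) : List LRow :=
  match L[k]? with
  | some (lab, rk) =>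
      (dualL ((dualL L).set (L.length - 1 - k)
          (lab, ⟨rk.A, 1 / 2, 0, - m1pow (gammaAt (rows L) k)⟩))).take k ++
        (lab, (⟨rk.A, -(1 / 2), 0, - rk.eta⟩ : Row)) :: L.drop (k + 1)
  | none => L

/-- Position of the row labeled `i`. -/
def posOf (L : List LRow) (i : ℕ) : ℕ := L.findIdx fun p => p.1 == i

/-- The partial dual `dual_i^+`, acting at the row labeled `i`. -/
def dualPlusLab (i : ℕ) (L : List LRow) : List LRow := dualPlusL (posOf L i) L

/-- Applicability of `dual_i^+` on a labeled symbol. -/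
def DualPlusApplicableLab (i : ℕ) (L : List LRow) : Prop :=
  i ∈ L.map Prod.fst ∧ DualPlusApplicable (rows L) (posOf L i)

/-- The partial dual `dual_i^-` on a labeled symbol. -/
def dualMinusLab (i : ℕ) (L : List LRow) : List LRow := dualL (dualPlusLab i (dualL L))

/-- Applicability of `dual_i^-` on a labeled symbol. -/
def DualMinusApplicableLab (i : ℕ) (L : List LRow) : Prop :=
  DualPlusApplicableLab i (dualL L)

/-- One basic operator step: a row exchange, a union-intersection, a composition
`dual ∘ ui_{i,j} ∘ dual`, or an inverse of one of these. -/
def BasicStep (L M : List LRow) : Prop :=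
  (∃ k, M = rexL k L) ∨ (∃ k, L = rexL k M) ∨
  (∃ i j, UIrel L i j M) ∨ (∃ i j, UIrel M i j L) ∨
  (∃ i j N, UIrel (dualL L) i j N ∧ M = dualL N) ∨
  (∃ i j N, UIrel (dualL M) i j N ∧ L = dualL N)

/-- Finite sequences of basic operators. -/
def Basic : List LRow → List LRow → Prop := Relation.ReflTransGen BasicStep

/-- Shift every row after position `j` one step to the right. -/
def shAfter (j : ℕ) (E : List Row) : List Row :=
  E.mapIdx fun i r => if j < i then r.sh 1 else r

/-- Shift every row with `B_i ≥ B` one step to the left. -/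
def shiftGE (B : ℚ) (E : List Row) : List Row :=
  E.map fun r => if B ≤ r.B then r.sh (-1) else r

/-- Shift every row with `B_i ≥ 1/2` one step to the left, deleting the rows of the
form `([1/2,1/2], 0, η)`. -/
def shiftHalfDel (E : List Row) : List Row :=
  (E.filter fun r => !decide (r.A = 1 / 2 ∧ r.B = 1 / 2 ∧ r.l = 0)).map
    fun r => if (1 / 2 : ℚ) ≤ r.B then r.sh (-1) else r

/-- The rows `([A-r, -(A-r)-1], ⌊A⌋-r, 1)` for `r = 0, …, ⌊A⌋`. -/
def prefixRows (A : ℚ) : List Row :=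
  (List.range (⌊A⌋.toNat + 1)).map fun r =>
    ⟨A - r, -(A - r) - 1, (⌊A⌋ : ℚ) - r, 1⟩

/-! ### Signed rows

A row with half-integral ends is encoded by integers `a`, `b`, `d`: the segment is
`[a + 1/2, b + 1/2]` and `d` is the length `A - B + 1 - 2l` of the middle part of the row,
with a sign recording `η` relative to the rows preceding it.  In these coordinates a row
exchange is a reflection, and Xu's conditions say that `d` is `1`-Lipschitz for the
`ℓ¹`-distance between segments. -/

/-- A signed row. -/
@[ext] structure SRow where
  a : ℤ
  b : ℤ
  d : ℤ

namespace SRow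

/-- Containment of segments. -/
def Inside (r s : SRow) : Prop := s.b ≤ r.b ∧ r.a ≤ s.a

instance (r s : SRow) : Decidable (r.Inside s) := by unfold Inside; infer_instance

/-- Strict precedence of segments in the product order. -/
def Prec (r s : SRow) : Prop := r.a < s.a ∧ r.b < s.b

/-- One of the segments strictly contains the other. -/
def Nested (r s : SRow) : Prop :=
  (r.Inside s ∨ s.Inside r) ∧ ¬ (r.Inside s ∧ s.Inside r)

/-- Xu's condition. -/
def Lip (r s : SRow) : Prop :=
  (r.d - s.d).natAbs ≤ (r.a - s.a).natAbs + (r.b - s.b).natAbs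

/-- The row with the value replaced by `c - d`. -/
def mirror (c : ℤ) (r : SRow) : SRow := ⟨r.a, r.b, c - r.d⟩

/-- The pair of rows produced by exchanging `r` and `s`. -/
def exch (r s : SRow) : SRow × SRow :=
  if r.Inside s then (s.mirror (2 * r.d), r) else (s, r.mirror (2 * s.d))

end SRow

open SRow

/-- An exchange of two adjacent rows, one of which contains the other. -/
inductive SStep : List SRow → List SRow → Prop
  | head (r s : SRow) (F : List SRow) : r.Inside s ∨ s.Inside r →
      SStep (r :: s :: F) ((exch r s).1 :: (exch r s).2 :: F)
  | cons (r : SRow) {F G : List SRow} : SStep F G → SStep (r :: F) (r :: G)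

/-- Admissibility of the order. -/
def Adm (F : List SRow) : Prop := F.Pairwise fun r s => ¬ s.Prec r

theorem SStep.exists_split {F G : List SRow} (h : SStep F G) :
    ∃ L r s R, F = L ++ r :: s :: R ∧ (r.Inside s ∨ s.Inside r) ∧
      G = L ++ (exch r s).1 :: (exch r s).2 :: R := by
  induction h with
  | head r s F h => exact ⟨[], r, s, F, rfl, h, rfl⟩
  | cons t _ ih =>
    obtain ⟨L, r, s, R, rfl, h, rfl⟩ := ih
    exact ⟨t :: L, r, s, R, rfl, h, rfl⟩

theorem exch_exch {r s : SRow} (h : r.Nested s) :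
    exch (exch r s).1 (exch r s).2 = (r, s) := by
  obtain ⟨a, b, d⟩ := r
  obtain ⟨a', b', d'⟩ := s
  simp only [Nested, exch, Inside, mirror] at *
  split_ifs <;> grind

theorem nested_exch {r s : SRow} (h : r.Nested s) :
    (exch r s).1.Nested (exch r s).2 := by
  obtain ⟨a, b, d⟩ := r
  obtain ⟨a', b', d'⟩ := s
  simp only [Nested, exch, Inside, mirror] at *
  split_ifs <;> grind

theorem lip_exch {r s : SRow} : (exch r s).1.Lip (exch r s).2 ↔ r.Lip s := by
  obtain ⟨a, b, d⟩ := r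
  obtain ⟨a', b', d'⟩ := s
  simp only [exch, Inside, mirror, Lip] at *
  split_ifs <;> grind

/-- Exchanging rows with the same segment does nothing when Xu's condition holds. -/
theorem exch_eq_of_not_nested {r s : SRow} (h : r.Inside s ∨ s.Inside r) (hn : ¬ r.Nested s)
    (hl : r.Lip s) : exch r s = (r, s) := by
  obtain ⟨a, b, d⟩ := r
  obtain ⟨a', b', d'⟩ := s
  simp only [Nested, exch, Inside, mirror, Lip] at *
  split_ifs <;> grind

@[simp] theorem exch_fst_a (r s : SRow) : (exch r s).1.a = s.a := by
  unfold exch; split_ifs <;> rfl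

@[simp] theorem exch_fst_b (r s : SRow) : (exch r s).1.b = s.b := by
  unfold exch; split_ifs <;> rfl

@[simp] theorem exch_snd_a (r s : SRow) : (exch r s).2.a = r.a := by
  unfold exch; split_ifs <;> rfl

@[simp] theorem exch_snd_b (r s : SRow) : (exch r s).2.b = r.b := by
  unfold exch; split_ifs <;> rfl

theorem exch_fst_d (r s : SRow) :
    (exch r s).1.d = if r.Inside s then 2 * r.d - s.d else s.d := by
  unfold exch; split_ifs <;> rfl

theorem exch_snd_d (r s : SRow) :
    (exch r s).2.d = if r.Inside s then r.d else 2 * s.d - r.d := by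
  unfold exch; split_ifs <;> rfl

/-- The braid relation for three pairwise nested rows. -/
theorem exch_braid {y r m : SRow} (hyr : y.Nested r) (hrm : r.Nested m) (hym : y.Nested m) :
    let p := exch y r
    let q := exch p.2 m
    let t := exch p.1 q.1
    let p' := exch r m
    let q' := exch y p'.1
    let t' := exch q'.2 p'.2
    q'.1 = t.1 ∧ t'.1 = t.2 ∧ t'.2 = q.2 := by
  obtain ⟨a, b, d⟩ := y
  obtain ⟨a', b', d'⟩ := r
  obtain ⟨a'', b'', d''⟩ := m
  simp only [Nested, Inside] at *
  by_cases h₁ : b' ≤ b ∧ a ≤ a' <;> by_cases h₂ : b'' ≤ b' ∧ a' ≤ a'' <;>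
    by_cases h₃ : b'' ≤ b ∧ a ≤ a'' <;>
    simp [exch, Inside, mirror, h₁, h₂, h₃] <;> omega

theorem Adm.exch {L R : List SRow} {r s : SRow} (h : Adm (L ++ r :: s :: R))
    (hn : r.Inside s ∨ s.Inside r) : Adm (L ++ (exch r s).1 :: (exch r s).2 :: R) := by
  have hrs : ¬ r.Prec s := by simp only [Inside, Prec] at *; omega
  simp only [Adm, List.pairwise_append, List.pairwise_cons, List.mem_cons, forall_eq_or_imp,
    Prec, exch_fst_a, exch_fst_b, exch_snd_a, exch_snd_b] at *
  grind

theorem Adm.sstep {F G : List SRow} (h : Adm F) (hG : SStep F G) : Adm G := by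
  obtain ⟨L, r, s, R, rfl, hrs, rfl⟩ := hG.exists_split
  exact h.exch hrs

/-! ### Normal forms

Fix `K ≥ 0`.  The partial dual replaces a row `x` with segment `(K, 0)` by a row `y` with
segment `(K, -1)`.  A list containing `y` is handled as a triple `(L, y, R)`.  The relation
`Sim` pairs such triples with lists containing `x`; its first two arguments record the parity
of the number of rows with `0 ≤ b` passed so far, as a sign, and their alternating sum. -/

/-- The segment is contained in `(K, -1)` and has the same lower end. -/
def Low (K : ℤ) (r : SRow) : Prop := r.b = -1 ∧ r.a ≤ K

instance (K : ℤ) (r : SRow) : Decidable (Low K r) := by unfold Low; infer_instance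

/-- The part of the correspondence to the right of the distinguished row. -/
inductive SimTail (K : ℤ) : ℤ → ℤ → List SRow → List SRow → Prop
  | nil {T P : ℤ} : SimTail K T P [] []
  | neg {T P : ℤ} {F R : List SRow} {r r' : SRow} : r'.a = r.a → r'.b = r.b → r'.d = -r.d →
      r.b < 0 → 1 - r.a + r.b ≤ T * r.d + 2 * P → ¬ Low K r → SimTail K T P F R →
      SimTail K T P (r :: F) (r' :: R)
  | pos {T P : ℤ} {F R : List SRow} {r r' : SRow} : r'.a = r.a → r'.b = r.b → r'.d = -r.d →
      0 ≤ r.b → SimTail K (-T) (P + T * r.d) F R → SimTail K T P (r :: F) (r' :: R)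

/-- The correspondence between lists with distinguished row `x` and triples `(L, y, R)`. -/
inductive Sim (K : ℤ) : ℤ → ℤ → List SRow → List SRow → SRow → List SRow → Prop
  | neg {T P : ℤ} {F L : List SRow} {y : SRow} {R : List SRow} {r r' : SRow} :
      r'.a = r.a → r'.b = r.b → r'.d = 2 * T - r.d → r.b < 0 →
      1 - r.a + r.b ≤ T * r.d + 2 * P → Sim K T P F L y R → Sim K T P (r :: F) (r' :: L) y R
  | pos {T P : ℤ} {F L : List SRow} {y : SRow} {R : List SRow} {r r' : SRow} :
      r'.a = r.a → r'.b = r.b → r'.d = -r.d → 0 ≤ r.b → r.a ≤ K →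
      T * r.d + 2 * P ≤ -(r.a - r.b + 1) → Sim K (-T) (P + T * r.d) F L y R →
      Sim K T P (r :: F) (r' :: L) y R
  | here {T P : ℤ} {F R : List SRow} {x y : SRow} : x.a = K → x.b = 0 → y.a = K → y.b = -1 →
      y.d = T - x.d → T * x.d + 2 * P = -(K + 1) → SimTail K (-T) (P + T * x.d) F R →
      Sim K T P (x :: F) [] y R

/-- Xu's conditions at all adjacent pairs. -/
abbrev LipChain (F : List SRow) : Prop := F.IsChain Lip

theorem SimTail.not_low {K T P : ℤ} {F R : List SRow} (h : SimTail K T P F R) :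
    ∀ r ∈ R, ¬ Low K r := by
  induction h <;> simp_all [Low]; omega

theorem Sim.not_low {K T P : ℤ} {F L : List SRow} {y : SRow} {R : List SRow}
    (h : Sim K T P F L y R) : ∀ r ∈ R, ¬ Low K r := by
  induction h with
  | neg _ _ _ _ _ _ ih => exact ih
  | pos _ _ _ _ _ _ _ ih => exact ih
  | here _ _ _ _ _ _ h => exact h.not_low

theorem Sim.seg {K T P : ℤ} {F L : List SRow} {y : SRow} {R : List SRow}
    (h : Sim K T P F L y R) : y.a = K ∧ y.b = -1 := by
  induction h with
  | neg _ _ _ _ _ _ ih => exact ih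
  | pos _ _ _ _ _ _ _ ih => exact ih
  | here _ _ ha hb _ _ _ => exact ⟨ha, hb⟩

theorem SimTail.congr {K T P T' P' : ℤ} {F R : List SRow} (h : SimTail K T P F R)
    (hT : T = T') (hP : P = P') : SimTail K T' P' F R := hT ▸ hP ▸ h

theorem Sim.congr {K T P T' P' : ℤ} {F L : List SRow} {y : SRow} {R : List SRow}
    (h : Sim K T P F L y R) (hT : T = T') (hP : P = P') : Sim K T' P' F L y R := hT ▸ hP ▸ h

theorem SimTail.exch {K T P : ℤ} (hT : T = 1 ∨ T = -1) {F R₁ R₂ : List SRow} {r s : SRow}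
    (h : SimTail K T P F (R₁ ++ r :: s :: R₂)) (hF : LipChain F) (hn : r.Nested s) :
    ∃ F', SStep F F' ∧
      SimTail K T P F' (R₁ ++ (SRow.exch r s).1 :: (SRow.exch r s).2 :: R₂) := by
  induction R₁ generalizing T P F with
  | nil =>
    rcases h with _ | ⟨ha, hb, hd, hneg, hN, hl, h⟩ | ⟨ha, hb, hd, hpos, h⟩ <;>
    rcases h with _ | ⟨ha', hb', hd', hneg', hN', hl', h⟩ | ⟨ha', hb', hd', hpos', h⟩ <;>
    have hL := (List.isChain_cons_cons.1 hF).1 <;>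
    simp only [Nested, Inside, Lip] at hn hL
    · rcases hT with rfl | rfl <;>
        refine ⟨_, .head _ _ _ ?_, .neg ?_ ?_ ?_ ?_ ?_ ?_
          (.neg ?_ ?_ ?_ ?_ ?_ ?_ (h.congr ?_ ?_))⟩ <;>
        simp only [Low, Inside, exch_fst_a, exch_fst_b, exch_fst_d, exch_snd_a, exch_snd_b,
          exch_snd_d] at * <;> grind
    · rcases hT with rfl | rfl <;>
        refine ⟨_, .head _ _ _ ?_, .pos ?_ ?_ ?_ ?_ (.neg ?_ ?_ ?_ ?_ ?_ ?_ (h.congr ?_ ?_))⟩ <;>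
        simp only [Low, Inside, exch_fst_a, exch_fst_b, exch_fst_d, exch_snd_a, exch_snd_b,
          exch_snd_d] at * <;> grind
    · rcases hT with rfl | rfl <;>
        refine ⟨_, .head _ _ _ ?_, .neg ?_ ?_ ?_ ?_ ?_ ?_ (.pos ?_ ?_ ?_ ?_ (h.congr ?_ ?_))⟩ <;>
        simp only [Low, Inside, exch_fst_a, exch_fst_b, exch_fst_d, exch_snd_a, exch_snd_b,
          exch_snd_d] at * <;> grind
    · rcases hT with rfl | rfl <;>
        refine ⟨_, .head _ _ _ ?_, .pos ?_ ?_ ?_ ?_ (.pos ?_ ?_ ?_ ?_ (h.congr ?_ ?_))⟩ <;>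
        simp only [Inside, exch_fst_a, exch_fst_b, exch_fst_d, exch_snd_a, exch_snd_b,
          exch_snd_d] at * <;> grind
  | cons t R₁ ih =>
    cases h with
    | neg ha hb hd hneg hN hl h =>
      obtain ⟨F', h₁, h₂⟩ := ih hT h hF.tail
      exact ⟨_, .cons _ h₁, .neg ha hb hd hneg hN hl h₂⟩
    | pos ha hb hd hpos h =>
      obtain ⟨F', h₁, h₂⟩ := ih (by omega) h hF.tail
      exact ⟨_, .cons _ h₁, .pos ha hb hd hpos h₂⟩

theorem Sim.exch_right {K T P : ℤ} (hT : T = 1 ∨ T = -1) {F L R₁ R₂ : List SRow} {y r s : SRow}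
    (h : Sim K T P F L y (R₁ ++ r :: s :: R₂)) (hF : LipChain F) (hn : r.Nested s) :
    ∃ F', SStep F F' ∧ Sim K T P F' L y (R₁ ++ (exch r s).1 :: (exch r s).2 :: R₂) := by
  induction L generalizing T P F with
  | nil =>
    cases h with
    | here hxa hxb ha hb hd hx h =>
      obtain ⟨F', h₁, h₂⟩ := h.exch (by omega) hF.tail hn
      exact ⟨_, .cons _ h₁, .here hxa hxb ha hb hd hx h₂⟩
  | cons t L ih =>
    cases h with
    | neg ha hb hd hneg hN h =>
      obtain ⟨F', h₁, h₂⟩ := ih hT h hF.tail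
      exact ⟨_, .cons _ h₁, .neg ha hb hd hneg hN h₂⟩
    | pos ha hb hd hpos hK hC h =>
      obtain ⟨F', h₁, h₂⟩ := ih (by omega) h hF.tail
      exact ⟨_, .cons _ h₁, .pos ha hb hd hpos hK hC h₂⟩

theorem Sim.exch_left {K T P : ℤ} (hT : T = 1 ∨ T = -1) {F L₁ L₂ R : List SRow} {y r s : SRow}
    (h : Sim K T P F (L₁ ++ r :: s :: L₂) y R) (hF : LipChain F) (hn : r.Nested s) :
    ∃ F', SStep F F' ∧ Sim K T P F' (L₁ ++ (exch r s).1 :: (exch r s).2 :: L₂) y R := by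
  induction L₁ generalizing T P F with
  | nil =>
    rcases h with ⟨ha, hb, hd, hneg, hN, h⟩ | ⟨ha, hb, hd, hpos, hK, hC, h⟩ <;>
    rcases h with ⟨ha', hb', hd', hneg', hN', h⟩ | ⟨ha', hb', hd', hpos', hK', hC', h⟩ <;>
    have hL := (List.isChain_cons_cons.1 hF).1 <;>
    simp only [Nested, Inside, Lip] at hn hL
    · rcases hT with rfl | rfl <;>
        refine ⟨_, .head _ _ _ ?_, .neg ?_ ?_ ?_ ?_ ?_ (.neg ?_ ?_ ?_ ?_ ?_ (h.congr ?_ ?_))⟩ <;>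
        simp only [Inside, exch_fst_a, exch_fst_b, exch_fst_d, exch_snd_a, exch_snd_b,
          exch_snd_d] at * <;> grind
    · rcases hT with rfl | rfl <;>
        refine ⟨_, .head _ _ _ ?_, .pos ?_ ?_ ?_ ?_ ?_ ?_ (.neg ?_ ?_ ?_ ?_ ?_ (h.congr ?_ ?_))⟩ <;>
        simp only [Inside, exch_fst_a, exch_fst_b, exch_fst_d, exch_snd_a, exch_snd_b,
          exch_snd_d] at * <;> grind
    · rcases hT with rfl | rfl <;>
        refine ⟨_, .head _ _ _ ?_, .neg ?_ ?_ ?_ ?_ ?_ (.pos ?_ ?_ ?_ ?_ ?_ ?_ (h.congr ?_ ?_))⟩ <;>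
        simp only [Inside, exch_fst_a, exch_fst_b, exch_fst_d, exch_snd_a, exch_snd_b,
          exch_snd_d] at * <;> grind
    · rcases hT with rfl | rfl <;>
        refine ⟨_, .head _ _ _ ?_, .pos ?_ ?_ ?_ ?_ ?_ ?_
          (.pos ?_ ?_ ?_ ?_ ?_ ?_ (h.congr ?_ ?_))⟩ <;>
        simp only [Inside, exch_fst_a, exch_fst_b, exch_fst_d, exch_snd_a, exch_snd_b,
          exch_snd_d] at * <;> grind
  | cons t L₁ ih =>
    cases h with
    | neg ha hb hd hneg hN h =>
      obtain ⟨F', h₁, h₂⟩ := ih hT h hF.tail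
      exact ⟨_, .cons _ h₁, .neg ha hb hd hneg hN h₂⟩
    | pos ha hb hd hpos hK hC h =>
      obtain ⟨F', h₁, h₂⟩ := ih (by omega) h hF.tail
      exact ⟨_, .cons _ h₁, .pos ha hb hd hpos hK hC h₂⟩

theorem Sim.move_left {K T P : ℤ} (hT : T = 1 ∨ T = -1) {F L R : List SRow} {y l : SRow}
    (h : Sim K T P F (L ++ [l]) y R) (hn : l.Nested y) (hl : ¬ Low K l) :
    ∃ F', SStep F F' ∧ Sim K T P F' L (exch l y).1 ((exch l y).2 :: R) := by
  induction L generalizing T P F with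
  | nil =>
    rcases h with ⟨ha, hb, hd, hneg, hN, h⟩ | ⟨ha, hb, hd, hpos, hK, hC, h⟩ <;>
    rcases h with _ | _ | ⟨hxa, hxb, hya, hyb, hyd, hx, h⟩ <;>
    simp only [Nested, Inside] at hn
    · rcases hT with rfl | rfl <;>
        refine ⟨_, .head _ _ _ ?_, .here ?_ ?_ ?_ ?_ ?_ ?_
          (.neg ?_ ?_ ?_ ?_ ?_ ?_ (h.congr ?_ ?_))⟩ <;>
        simp only [Low, Inside, exch_fst_a, exch_fst_b, exch_fst_d, exch_snd_a, exch_snd_b,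
          exch_snd_d] at * <;> grind
    · rcases hT with rfl | rfl <;>
        refine ⟨_, .head _ _ _ ?_, .here ?_ ?_ ?_ ?_ ?_ ?_ (.pos ?_ ?_ ?_ ?_ (h.congr ?_ ?_))⟩ <;>
        simp only [Low, Inside, exch_fst_a, exch_fst_b, exch_fst_d, exch_snd_a, exch_snd_b,
          exch_snd_d] at * <;> grind
  | cons t L ih =>
    cases h with
    | neg ha hb hd hneg hN h =>
      obtain ⟨F', h₁, h₂⟩ := ih hT h
      exact ⟨_, .cons _ h₁, .neg ha hb hd hneg hN h₂⟩
    | pos ha hb hd hpos hK hC h =>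
      obtain ⟨F', h₁, h₂⟩ := ih (by omega) h
      exact ⟨_, .cons _ h₁, .pos ha hb hd hpos hK hC h₂⟩

theorem Sim.move_right {K T P : ℤ} (hT : T = 1 ∨ T = -1) {F L R : List SRow} {y r : SRow}
    (h : Sim K T P F L y (r :: R)) (hF : LipChain F) (hn : y.Nested r) :
    ∃ F', SStep F F' ∧ Sim K T P F' (L ++ [(exch y r).1]) (exch y r).2 R := by
  induction L generalizing T P F with
  | nil =>
    rcases h with _ | _ | ⟨hxa, hxb, hya, hyb, hyd, hx, h⟩
    rcases h with _ | ⟨ha, hb, hd, hneg, hN, hl, h⟩ | ⟨ha, hb, hd, hpos, h⟩ <;>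
    have hL := (List.isChain_cons_cons.1 hF).1 <;>
    simp only [Nested, Inside, Lip] at hn hL
    · rcases hT with rfl | rfl <;>
        refine ⟨_, .head _ _ _ ?_, .neg ?_ ?_ ?_ ?_ ?_
          (.here ?_ ?_ ?_ ?_ ?_ ?_ (h.congr ?_ ?_))⟩ <;>
        simp only [Low, Inside, exch_fst_a, exch_fst_b, exch_fst_d, exch_snd_a, exch_snd_b,
          exch_snd_d] at * <;> grind
    · rcases hT with rfl | rfl <;>
        refine ⟨_, .head _ _ _ ?_, .pos ?_ ?_ ?_ ?_ ?_ ?_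
          (.here ?_ ?_ ?_ ?_ ?_ ?_ (h.congr ?_ ?_))⟩ <;>
        simp only [Inside, exch_fst_a, exch_fst_b, exch_fst_d, exch_snd_a, exch_snd_b,
          exch_snd_d] at * <;> grind
  | cons t L ih =>
    cases h with
    | neg ha hb hd hneg hN h =>
      obtain ⟨F', h₁, h₂⟩ := ih hT h hF.tail
      exact ⟨_, .cons _ h₁, .neg ha hb hd hneg hN h₂⟩
    | pos ha hb hd hpos hK hC h =>
      obtain ⟨F', h₁, h₂⟩ := ih (by omega) h hF.tail
      exact ⟨_, .cons _ h₁, .pos ha hb hd hpos hK hC h₂⟩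

theorem SimTail.lipChain {K T P : ℤ} {F R : List SRow} (h : SimTail K T P F R)
    (hF : LipChain F) : LipChain R := by
  induction h with
  | nil => exact hF
  | neg ha hb hd _ _ _ h ih | pos ha hb hd _ h ih =>
    have := ih hF.tail
    cases h <;> simp only [List.isChain_cons_cons, List.isChain_singleton, Lip] at * <;> grind

theorem Sim.lipChain {K T P : ℤ} (hT : T = 1 ∨ T = -1) {F L R : List SRow} {y : SRow}
    (h : Sim K T P F L y R) (hF : LipChain F) (hR : ∀ r ∈ R, ¬ r.Prec y) :
    LipChain (L ++ y :: R) := by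
  induction h with
  | here hxa hxb hya hyb hyd hx h =>
    have := h.lipChain hF.tail
    rcases hT with rfl | rfl <;> cases h <;>
      simp only [List.nil_append, List.isChain_cons_cons, List.isChain_singleton, Lip, Low, Prec,
        List.mem_cons, forall_eq_or_imp] at * <;> grind
  | neg ha hb hd hneg hN h ih =>
    have := ih hT hF.tail hR
    rcases hT with rfl | rfl <;> cases h <;>
      simp only [List.nil_append, List.cons_append, List.isChain_cons_cons, Lip] at * <;> grind
  | pos ha hb hd hpos hK hC h ih =>
    have := ih (by omega) hF.tail hR
    rcases hT with rfl | rfl <;> cases h <;>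
      simp only [List.nil_append, List.cons_append, List.isChain_cons_cons, Lip] at * <;> grind

/-! ### Triples reachable from normal forms -/

/-- Xu's conditions hold for all reorderings. -/
def LipReorder (F₀ : List SRow) : Prop := ∀ F, Relation.ReflTransGen SStep F₀ F → LipChain F

/-- The triple corresponds to a reordering of `F₀`. -/
def Normal (K : ℤ) (F₀ L : List SRow) (y : SRow) (R : List SRow) : Prop :=
  ∃ F, Relation.ReflTransGen SStep F₀ F ∧ Sim K 1 0 F L y R ∧ Adm (L ++ y :: R)

/-- Triples which become normal after moving the distinguished row to the right. -/
inductive Good (K : ℤ) (F₀ : List SRow) : List SRow → SRow → List SRow → Prop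
  | base {L : List SRow} {y : SRow} {R : List SRow} : Normal K F₀ L y R → Good K F₀ L y R
  | step {L : List SRow} {y r : SRow} {R : List SRow} : y.Nested r →
      Good K F₀ (L ++ [(exch y r).1]) (exch y r).2 R → Good K F₀ L y (r :: R)

section

variable {K : ℤ} {F₀ : List SRow} {L L₁ L₂ R R₁ R₂ : List SRow} {y l r s : SRow}

theorem nested_congr {r s r' s' : SRow} (h : r.Nested s) (ha : r'.a = r.a) (hb : r'.b = r.b)
    (ha' : s'.a = s.a) (hb' : s'.b = s.b) : r'.Nested s' := by
  simp only [Nested, Inside, ha, hb, ha', hb'] at *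
  exact h

theorem Normal.exch_left (H : LipReorder F₀)
    (h : Normal K F₀ (L₁ ++ r :: s :: L₂) y R) (hn : r.Nested s) :
    Normal K F₀ (L₁ ++ (exch r s).1 :: (exch r s).2 :: L₂) y R := by
  obtain ⟨F, hF, hS, hA⟩ := h
  obtain ⟨F', h₁, h₂⟩ := hS.exch_left (.inl rfl) (H F hF) hn
  refine ⟨F', hF.tail h₁, h₂, ?_⟩
  simp only [List.append_assoc, List.cons_append] at hA ⊢
  exact hA.exch hn.1

theorem Normal.exch_right (H : LipReorder F₀)
    (h : Normal K F₀ L y (R₁ ++ r :: s :: R₂)) (hn : r.Nested s) :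
    Normal K F₀ L y (R₁ ++ (exch r s).1 :: (exch r s).2 :: R₂) := by
  obtain ⟨F, hF, hS, hA⟩ := h
  obtain ⟨F', h₁, h₂⟩ := hS.exch_right (.inl rfl) (H F hF) hn
  refine ⟨F', hF.tail h₁, h₂, ?_⟩
  rw [← List.cons_append, ← List.append_assoc] at hA ⊢
  exact hA.exch hn.1

theorem Normal.move_left (h : Normal K F₀ (L ++ [l]) y R) (hn : l.Nested y) (hl : ¬ Low K l) :
    Normal K F₀ L (exch l y).1 ((exch l y).2 :: R) := by
  obtain ⟨F, hF, hS, hA⟩ := h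
  obtain ⟨F', h₁, h₂⟩ := hS.move_left (.inl rfl) hn hl
  refine ⟨F', hF.tail h₁, h₂, Adm.exch ?_ hn.1⟩
  simpa using hA

theorem Normal.move_right (H : LipReorder F₀)
    (h : Normal K F₀ L y (r :: R)) (hn : y.Nested r) :
    Normal K F₀ (L ++ [(exch y r).1]) (exch y r).2 R := by
  obtain ⟨F, hF, hS, hA⟩ := h
  obtain ⟨F', h₁, h₂⟩ := hS.move_right (.inl rfl) (H F hF) hn
  refine ⟨F', hF.tail h₁, h₂, ?_⟩
  simpa using hA.exch hn.1

theorem Normal.lipChain (H : LipReorder F₀)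
    (h : Normal K F₀ L y R) : LipChain (L ++ y :: R) := by
  obtain ⟨F, hF, hS, hA⟩ := h
  refine hS.lipChain (.inl rfl) (H F hF) fun r hr => ?_
  simp only [Adm, List.pairwise_append, List.pairwise_cons] at hA
  exact hA.2.1.1 r hr

theorem Good.seg (h : Good K F₀ L y R) : y.a = K ∧ y.b = -1 := by
  induction h with
  | base h => obtain ⟨F, -, h, -⟩ := h; exact h.seg
  | step _ _ ih => simpa using ih

theorem Good.adm (h : Good K F₀ L y R) : Adm (L ++ y :: R) := by
  induction h with
  | base h => obtain ⟨F, -, -, h⟩ := h; exact h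
  | step hn _ ih =>
    rw [List.append_assoc, List.singleton_append] at ih
    simpa [exch_exch hn] using ih.exch (nested_exch hn).1

theorem Good.not_prec (h : Good K F₀ L y R) : ∀ r ∈ R, ¬ (r.a < K ∧ r.b < -1) := by
  have hA := h.adm
  simp only [Adm, List.pairwise_append, List.pairwise_cons, Prec, h.seg] at hA
  exact hA.2.1.1

theorem Good.seg_ne (h : Good K F₀ L y R) : ∀ r ∈ R, ¬ (r.a = K ∧ r.b = -1) := by
  induction h with
  | base h =>
    obtain ⟨F, -, h, -⟩ := h
    intro r hr hr'
    exact h.not_low r hr ⟨hr'.2, hr'.1.le⟩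
  | step hn h ih =>
    have := h.seg
    simp only [exch_snd_a, exch_snd_b, Nested, Inside] at *
    simp only [List.mem_cons, forall_eq_or_imp]
    exact ⟨by omega, ih⟩

theorem Good.normal (h : Good K F₀ L y R) (hR : ∀ r ∈ R, ¬ Low K r) : Normal K F₀ L y R := by
  induction h with
  | base h => exact h
  | step hn h ih =>
    simp only [List.mem_cons, forall_eq_or_imp] at hR
    have := (ih hR.2).move_left (nested_exch hn) (by simpa [Low] using hR.1)
    rwa [exch_exch hn] at this

theorem Good.exch_left (H : LipReorder F₀)
    (h : Good K F₀ (L₁ ++ r :: s :: L₂) y R) (hn : r.Nested s) :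
    Good K F₀ (L₁ ++ (exch r s).1 :: (exch r s).2 :: L₂) y R := by
  generalize hL : L₁ ++ r :: s :: L₂ = L at h
  induction h generalizing L₂ with
  | base h => subst hL; exact .base (h.exch_left H hn)
  | step hn' h ih =>
    subst hL
    refine .step hn' ?_
    simpa using ih (L₂ := L₂ ++ [_]) (by simp)

theorem Good.move_left (h : Good K F₀ (L ++ [l]) y R) (hn : l.Nested y) :
    Good K F₀ L (exch l y).1 ((exch l y).2 :: R) :=
  .step (nested_exch hn) (by rwa [exch_exch hn])

theorem Good.move_right (H : LipReorder F₀)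
    (h : Good K F₀ L y (r :: R)) (hn : y.Nested r) :
    Good K F₀ (L ++ [(exch y r).1]) (exch y r).2 R := by
  cases h with
  | base h => exact .base (h.move_right H hn)
  | step _ h => exact h

theorem Good.exch_right (H : LipReorder F₀)
    (h : Good K F₀ L y (R₁ ++ r :: s :: R₂)) (hn : r.Nested s) :
    Good K F₀ L y (R₁ ++ (exch r s).1 :: (exch r s).2 :: R₂) := by
  generalize hR : R₁ ++ r :: s :: R₂ = R at h
  induction h generalizing R₁ with
  | base h => subst hR; exact .base (h.exch_right H hn)
  | @step L y t R hn' h ih =>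
    cases R₁ with
    | cons t' R₁ =>
      obtain ⟨rfl, rfl⟩ : t' = t ∧ R₁ ++ r :: s :: R₂ = R := by simpa using hR
      exact .step hn' (ih rfl)
    | nil =>
      obtain ⟨rfl, rfl⟩ : r = t ∧ s :: R₂ = R := by simpa using hR
      have h₀ : Good K F₀ L y (r :: s :: R₂) := .step hn' h
      by_cases hys : y.Nested s
      · have hb := exch_braid hn' hn hys
        have h₂ := h.move_right H (nested_congr hys (by simp) (by simp) rfl rfl)
        rw [List.append_assoc] at h₂
        have h₃ := h₂.exch_left H (nested_congr hn (by simp) (by simp) (by simp) (by simp))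
        obtain ⟨e₁, e₂, e₃⟩ := hb
        refine .step (nested_congr hys rfl rfl (by simp) (by simp))
          (.step (nested_congr hn' (by simp) (by simp) (by simp) (by simp)) ?_)
        rw [e₁, e₂, e₃, List.append_assoc]
        exact h₃
      · refine .base (Normal.exch_right H (R₁ := []) (h₀.normal ?_) hn)
        have hs := h₀.seg
        have hA := h₀.adm
        have hne := h₀.seg_ne s (by simp)
        have hp := h₀.not_prec s (by simp)
        simp only [Adm, List.pairwise_append, List.pairwise_cons, Prec] at hA
        simp only [Nested, Inside] at hn hys
        have hs' : K < s.a ∧ -1 < s.b := by omega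
        intro u hu hu'
        simp only [Low] at hu'
        rcases List.mem_cons.1 hu with rfl | hu
        · omega
        rcases List.mem_cons.1 hu with rfl | hu
        · omega
        · have := hA.2.1.2.2.1 u hu
          omega
end

theorem append_cons_eq_append_cons_cons {α : Type*} {L R A B : List α} {y r s : α}
    (h : L ++ y :: R = A ++ r :: s :: B) :
    (∃ L₂, L = A ++ r :: s :: L₂ ∧ B = L₂ ++ y :: R) ∨ (L = A ++ [r] ∧ y = s ∧ R = B) ∨
      (L = A ∧ y = r ∧ R = s :: B) ∨ ∃ R₁, R = R₁ ++ r :: s :: B ∧ A = L ++ y :: R₁ := by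
  induction A generalizing L with
  | nil => rcases L with _ | ⟨_, _ | ⟨_, L⟩⟩ <;> simp_all
  | cons t A ih =>
    cases L with
    | nil => simp_all
    | cons t' L =>
      simp only [List.cons_append, List.cons.injEq] at h ⊢
      obtain ⟨rfl, h⟩ := h
      simpa using ih h

theorem LipChain.lip {A B : List SRow} {r s : SRow} (h : LipChain (A ++ r :: s :: B)) :
    r.Lip s := 
  (List.isChain_append_cons_cons.1 h).2.1

/-- The number of low rows. -/
def lowCount (K : ℤ) (R : List SRow) : ℕ := R.countP fun r => decide (Low K r)

section

variable {K : ℤ} {F₀ L R R₁ R₂ : List SRow} {y l r s u : SRow}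

theorem lowCount_cons_of_low (h : Low K r) : lowCount K (r :: R) = lowCount K R + 1 :=
  List.countP_cons_of_pos (by simpa using h)

theorem lowCount_cons_of_not_low (h : ¬ Low K r) : lowCount K (r :: R) = lowCount K R :=
  List.countP_cons_of_neg (by simpa using h)

theorem low_congr (ha : r.a = s.a) (hb : r.b = s.b) : Low K r ↔ Low K s := by
  simp only [Low, ha, hb]

theorem Good.nested_of_low (h : Good K F₀ L y R) (hu : u ∈ R) (hl : Low K u) : y.Nested u := by
  have h₁ := h.seg
  have h₂ := h.seg_ne u hu
  simp only [Low, Nested, Inside] at *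
  omega

theorem Good.bring_low (H : LipReorder F₀) (h : Good K F₀ L y (R₁ ++ u :: R₂)) (hu : Low K u)
    (hR : ∀ r ∈ R₁, ¬ Low K r) : ∃ v R', Low K v ∧ Good K F₀ L y (v :: R') ∧
      lowCount K R' = lowCount K R₂ := by
  induction R₁ using List.reverseRecOn generalizing u R₂ with
  | nil => exact ⟨u, R₂, hu, h, rfl⟩
  | append_singleton R₁ r ih =>
    rw [List.append_assoc, List.singleton_append] at h
    have hr : ¬ Low K r := hR r (by simp)
    have hp := h.not_prec r (by simp)
    have hA := h.adm
    simp only [Adm, List.pairwise_append, List.pairwise_cons, Prec, List.mem_cons,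
      forall_eq_or_imp] at hA
    have hru := hA.2.1.2.2.1.1.1
    have hn : r.Nested u := by
      simp only [Nested, Inside, Low] at *; omega
    obtain ⟨v, R', hv, h', hc⟩ := ih (h.exch_right H hn) ((low_congr (by simp) (by simp)).2 hu)
      fun s hs => hR s (by simp [hs])
    refine ⟨v, R', hv, h', hc.trans (lowCount_cons_of_not_low ?_)⟩
    rwa [low_congr (exch_snd_a r u) (exch_snd_b r u)]

theorem exists_first_low (h : 0 < lowCount K R) : ∃ R₁ u R₂, R = R₁ ++ u :: R₂ ∧ Low K u ∧
    (∀ r ∈ R₁, ¬ Low K r) ∧ lowCount K R = lowCount K R₂ + 1 := by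
  induction R with
  | nil => simp [lowCount] at h
  | cons r R ih =>
    by_cases hr : Low K r
    · exact ⟨[], r, R, rfl, hr, by simp, lowCount_cons_of_low hr⟩
    · rw [lowCount_cons_of_not_low hr] at h ⊢
      obtain ⟨R₁, u, R₂, rfl, hu, hR, hc⟩ := ih h
      exact ⟨r :: R₁, u, R₂, rfl, hu, by simpa using ⟨hr, hR⟩, hc⟩

/-- Moving the distinguished row past a low row. -/
theorem Good.exists_low (H : LipReorder F₀) (h : Good K F₀ L y R) (hR : 0 < lowCount K R) :
    ∃ u v R', Low K u ∧ v.a = y.a ∧ v.b = y.b ∧ v.d = 2 * u.d - y.d ∧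
      Good K F₀ (L ++ [u]) v R' ∧ lowCount K R = lowCount K R' + 1 := by
  obtain ⟨R₁, u, R₂, rfl, hu, hR₁, hc⟩ := exists_first_low hR
  obtain ⟨u, R', hu, h', hc'⟩ := h.bring_low H hu hR₁
  have hn := h'.nested_of_low (by simp) hu
  have hs := h'.seg
  have h'' := h'.move_right H hn
  have hi : ¬ y.Inside u := by
    simp only [Nested, Inside, Low] at *; omega
  rw [show (exch y u).1 = u by simp [exch, hi]] at h''
  exact ⟨u, (exch y u).2, R', hu, by simp, by simp, by simp [exch_snd_d, hi], h'', by omega⟩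

theorem Good.nested_head (h : Good K F₀ L y (r :: R)) (hR : 0 < lowCount K (r :: R)) :
    y.Nested r := by
  by_cases hr : Low K r
  · exact h.nested_of_low (by simp) hr
  rw [lowCount_cons_of_not_low hr] at hR
  obtain ⟨R₁, u, R₂, rfl, hu, -⟩ := exists_first_low hR
  have hs := h.seg
  have hne := h.seg_ne r (by simp)
  have hp := h.not_prec r (by simp)
  have hA := h.adm
  simp only [Adm, List.pairwise_append, List.pairwise_cons] at hA
  have hur := hA.2.1.2.1 u (by simp)
  simp only [Low, Nested, Inside, Prec] at *
  omega

variable {n : ℕ}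

theorem Good.lip_left (H : LipReorder F₀)
    (ih : ∀ L y R, Good K F₀ L y R → lowCount K R < n → LipChain (L ++ y :: R))
    (h : Good K F₀ (L ++ [l]) y R) (hR : 0 < lowCount K R) (hn : lowCount K R ≤ n) :
    l.Lip y := by
  obtain ⟨u, v, R', hu, hva, hvb, hvd, h', hc⟩ := h.exists_low H hR
  have hs := h.seg
  rw [List.append_assoc, List.singleton_append] at h'
  have hch := ih _ _ _ h' (by omega)
  have hch₁ : LipChain (L ++ l :: u :: v :: R') := by simpa using hch
  have hch₂ : LipChain ((L ++ [l]) ++ u :: v :: R') := by simpa using hch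
  have h₁ := hch₁.lip
  have h₂ := hch₂.lip
  by_cases hlu : l.Nested u ∧ u.Inside l
  · have hi : ¬ l.Inside u := by simp only [Nested] at hlu; tauto
    have h'' := ih _ _ _ (h'.exch_left H hlu.1) (by omega)
    have hch₃ : LipChain ((L ++ [(exch l u).1]) ++ (exch l u).2 :: v :: R') := by simpa using h''
    have h₃ := hch₃.lip
    simp only [Lip, exch_snd_a, exch_snd_b, exch_snd_d, if_neg hi] at *
    omega
  · have hA := h'.adm
    simp only [Adm, List.pairwise_append, List.pairwise_cons, List.mem_cons,
      forall_eq_or_imp] at hA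
    have hlu' := hA.1.2.1.1.1
    simp only [Nested, Inside, Lip, Low, Prec] at *
    omega

theorem Good.lip_right (H : LipReorder F₀)
    (ih : ∀ L y R, Good K F₀ L y R → lowCount K R < n → LipChain (L ++ y :: R))
    (h : Good K F₀ L y (r :: R)) (hR : 0 < lowCount K (r :: R))
    (hn : lowCount K (r :: R) ≤ n) : y.Lip r := by
  have h' := h.move_right H (h.nested_head hR)
  rw [← lip_exch]
  by_cases hr : Low K r
  · rw [lowCount_cons_of_low hr] at hn
    have := ih _ _ _ h' hn
    rw [← List.append_cons] at this
    exact this.lip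
  · rw [lowCount_cons_of_not_low hr] at hR hn
    exact h'.lip_left H ih hR hn

theorem Good.lipChain_left (H : LipReorder F₀)
    (ih : ∀ L y R, Good K F₀ L y R → lowCount K R < n → LipChain (L ++ y :: R))
    (h : Good K F₀ L y R) (hR : 0 < lowCount K R) (hn : lowCount K R ≤ n) : LipChain L := by
  obtain ⟨u, v, R', -, -, -, -, h', hc⟩ := h.exists_low H hR
  have := ih _ _ _ h' (by omega)
  rw [LipChain, List.append_assoc, List.isChain_append] at this
  exact this.1

theorem Good.lip_tail_head (H : LipReorder F₀)
    (ih : ∀ L y R, Good K F₀ L y R → lowCount K R < n → LipChain (L ++ y :: R))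
    (h : Good K F₀ L y (r :: s :: R)) (hR : 0 < lowCount K (r :: s :: R))
    (hn : lowCount K (r :: s :: R) ≤ n) : r.Lip s := by
  have hyr := h.nested_head hR
  have h₁ := h.move_right H hyr
  have hs := h.seg
  by_cases hr : Low K r
  · rw [lowCount_cons_of_low hr] at hn
    have hch := ih _ _ _ h₁ hn
    have hch₁ : LipChain (L ++ (exch y r).1 :: (exch y r).2 :: s :: R) := by simpa using hch
    have l₁ := hch₁.lip
    have l₂ := hch.lip
    by_cases hys : y.Nested s ∧ s.Inside y
    · have h₂ := h₁.move_right H (nested_congr hys.1 (by simp) (by simp) rfl rfl)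
      have hle : lowCount K R ≤ lowCount K (s :: R) := by
        by_cases hs : Low K s
        · rw [lowCount_cons_of_low hs]; omega
        · rw [lowCount_cons_of_not_low hs]
      have hch₂ := ih _ _ _ h₂ (by omega)
      rw [List.append_assoc, List.append_assoc, List.singleton_append, List.singleton_append]
        at hch₂
      have := hch₂.lip
      simp only [Nested, Inside, Lip, Low, exch_fst_a, exch_fst_b, exch_fst_d, exch_snd_a,
        exch_snd_b, exch_snd_d] at *
      grind
    · have hne := h.seg_ne s (by simp)
      have hp := h.not_prec s (by simp)
      simp only [Nested, Inside, Lip, Low, exch_fst_a, exch_fst_b, exch_fst_d, exch_snd_a,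
        exch_snd_b, exch_snd_d] at *
      grind
  · rw [lowCount_cons_of_not_low hr] at hR hn
    have l₁ := h₁.lip_left H ih hR hn
    have l₂ := h₁.lip_right H ih hR hn
    have hys := h₁.nested_head hR
    have h₂ := h₁.move_right H hys
    rw [List.append_assoc, List.singleton_append] at h₂
    have l₃ : (exch y r).1.Lip (exch (exch y r).2 s).1 := by
      by_cases hs : Low K s
      · rw [lowCount_cons_of_low hs] at hn
        have := ih _ _ _ h₂ hn
        rw [List.append_assoc] at this
        exact this.lip
      · rw [lowCount_cons_of_not_low hs] at hR hn
        exact (h₂.lipChain_left H ih hR hn).lip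
    simp only [Nested, Inside, Lip, Low, exch_fst_a, exch_fst_b, exch_fst_d, exch_snd_a,
      exch_snd_b, exch_snd_d] at *
    grind

theorem Good.lip_tail (H : LipReorder F₀)
    (ih : ∀ L y R, Good K F₀ L y R → lowCount K R < n → LipChain (L ++ y :: R))
    (h : Good K F₀ L y (R₁ ++ r :: s :: R₂)) (hR : 0 < lowCount K (R₁ ++ r :: s :: R₂))
    (hn : lowCount K (R₁ ++ r :: s :: R₂) ≤ n) : r.Lip s := by
  induction R₁ generalizing L y with
  | nil => exact h.lip_tail_head H ih hR hn
  | cons t R₁ ih' =>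
    rw [List.cons_append] at h hR hn
    have h₁ := h.move_right H (h.nested_head hR)
    by_cases ht : Low K t
    · rw [lowCount_cons_of_low ht] at hn
      have := ih _ _ _ h₁ hn
      rw [← List.cons_append, ← List.append_assoc] at this
      exact this.lip
    · rw [lowCount_cons_of_not_low ht] at hR hn
      exact ih' h₁ hR hn

/-- Good triples satisfy Xu's conditions. -/
theorem Good.lipChain (H : LipReorder F₀) (h : Good K F₀ L y R) : LipChain (L ++ y :: R) := by
  induction hn : lowCount K R using Nat.strong_induction_on generalizing L y R with
  | _ n ih =>
    have ih' : ∀ L y R, Good K F₀ L y R → lowCount K R < n → LipChain (L ++ y :: R) :=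
      fun L y R h hlt => ih _ hlt h rfl
    by_cases hR : 0 < lowCount K R
    · refine List.isChain_iff_forall_rel_of_append_cons_cons.2 fun r s A B e => ?_
      rcases append_cons_eq_append_cons_cons e with
        ⟨L₂, rfl, -⟩ | ⟨rfl, rfl, rfl⟩ | ⟨rfl, rfl, rfl⟩ | ⟨R₁, rfl, -⟩
      · exact (h.lipChain_left H ih' hR hn.le).lip
      · exact h.lip_left H ih' hR hn.le
      · exact h.lip_right H ih' hR hn.le
      · exact h.lip_tail H ih' hR hn.le
    · refine (h.normal fun r hr hl => hR ?_).lipChain H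
      exact List.countP_pos_iff.2 ⟨r, hr, by simpa using hl⟩

/-- Row exchanges preserve good triples. -/
theorem Good.sstep (H : LipReorder F₀) {G : List SRow} (h : Good K F₀ L y R)
    (hG : SStep (L ++ y :: R) G) : ∃ L' y' R', Good K F₀ L' y' R' ∧ G = L' ++ y' :: R' := by
  obtain ⟨A, r, s, B, e, hrs, rfl⟩ := hG.exists_split
  by_cases hn : r.Nested s
  · rcases append_cons_eq_append_cons_cons e with
      ⟨L₂, rfl, rfl⟩ | ⟨rfl, rfl, rfl⟩ | ⟨rfl, rfl, rfl⟩ | ⟨R₁, rfl, rfl⟩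
    · exact ⟨_, _, _, h.exch_left H hn, by simp⟩
    · exact ⟨_, _, _, h.move_left hn, rfl⟩
    · exact ⟨_, _, _, h.move_right H hn, by simp⟩
    · exact ⟨_, _, _, h.exch_right H hn, by simp⟩
  · have hl : r.Lip s := (e ▸ h.lipChain H : LipChain (A ++ r :: s :: B)).lip
    rw [exch_eq_of_not_nested hrs hn hl]
    exact ⟨L, y, R, h, e.symm⟩

theorem Good.lipReorder (H : LipReorder F₀) (h : Good K F₀ L y R) : LipReorder (L ++ y :: R) := by
  intro F hF
  have : ∃ L' y' R', Good K F₀ L' y' R' ∧ F = L' ++ y' :: R' := by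
    induction hF with
    | refl => exact ⟨L, y, R, h, rfl⟩
    | tail _ hs ih =>
      obtain ⟨L', y', R', h', rfl⟩ := ih
      exact h'.sstep H hs
  obtain ⟨L', y', R', h', rfl⟩ := this
  exact h'.lipChain H

end

/-! ### The partial dual of a list of signed rows -/

/-- The effect of the partial dual on a list `F₁ ++ x :: F₂`, where `x` has segment `(K, 0)`. -/
def pdual (K : ℤ) (F₁ F₂ : List SRow) : List SRow :=
  F₁.map (mirror 2) ++ ⟨K, -1, K + 2⟩ :: F₂.map (mirror 0)

theorem simTail_of_nonneg {K T P : ℤ} {F : List SRow} (h : ∀ r ∈ F, 0 ≤ r.b) :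
    SimTail K T P F (F.map (mirror 0)) := by
  induction F generalizing T P with
  | nil => exact .nil
  | cons r F ih =>
    exact .pos rfl rfl (zero_sub _) (h r (by simp)) (ih fun s hs => h s (by simp [hs]))

theorem sim_pdual {K : ℤ} {F₁ F₂ : List SRow}
    (h₁ : ∀ r ∈ F₁, r.b < 0 ∧ 1 - r.a + r.b ≤ r.d) (h₂ : ∀ r ∈ F₂, 0 ≤ r.b) :
    Sim K 1 0 (F₁ ++ ⟨K, 0, -(K + 1)⟩ :: F₂) (F₁.map (mirror 2)) ⟨K, -1, K + 2⟩
      (F₂.map (mirror 0)) := by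
  induction F₁ with
  | nil => exact .here rfl rfl rfl rfl (by ring) (by ring) (simTail_of_nonneg h₂)
  | cons r F₁ ih =>
    have := h₁ r (by simp)
    exact .neg rfl rfl rfl this.1 (by omega) (ih fun s hs => h₁ s (by simp [hs]))

/-- The partial dual preserves Xu's conditions. -/
theorem LipReorder.pdual {K : ℤ} {F₁ F₂ : List SRow}
    (h₁ : ∀ r ∈ F₁, r.b < 0 ∧ 1 - r.a + r.b ≤ r.d) (h₂ : ∀ r ∈ F₂, 0 ≤ r.b)
    (hA : Adm (pdual K F₁ F₂)) (H : LipReorder (F₁ ++ ⟨K, 0, -(K + 1)⟩ :: F₂)) :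
    LipReorder (pdual K F₁ F₂) :=
  Good.lipReorder H (.base ⟨_, .refl, sim_pdual h₁ h₂, hA⟩)

/-! ### Signed rows of a symbol -/

/-- `(-1)^n`. -/
def sg (n : ℤ) : ℤ := if n % 2 = 0 then 1 else -1

theorem sg_eq (n : ℤ) : sg n = 1 ∨ sg n = -1 := by unfold sg; split_ifs <;> simp

theorem sg_add (m n : ℤ) : sg (m + n) = sg m * sg n := by
  unfold sg; split_ifs <;> first | rfl | omega

theorem sg_congr {m n : ℤ} (h : (m - n) % 2 = 0) : sg m = sg n := by
  unfold sg; split_ifs <;> first | rfl | omega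

theorem sg_succ (n : ℤ) : sg (n + 1) = -sg n := by
  rw [sg_add]; simp [sg]

theorem m1pow_intCast (n : ℤ) : m1pow n = sg n := by simp [m1pow, sg]

theorem le_iff_of_sub_eq {p q : ℚ} {m n : ℤ} (h : q - p = n - m) : p ≤ q ↔ m ≤ n := by
  rw [← sub_nonneg, h, ← Int.cast_sub, Int.cast_nonneg_iff, sub_nonneg]

theorem lt_iff_of_sub_eq {p q : ℚ} {m n : ℤ} (h : q - p = n - m) : p < q ↔ m < n := by
  rw [← sub_pos, h, ← Int.cast_sub, Int.cast_pos, sub_pos]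

/-- `m` is the signed row of `r`, shifted by `c`, relative to the sign `T` of the preceding
rows. -/
def Rep1 (c T : ℤ) (r : Row) (m : SRow) : Prop :=
  r.A = m.a + c + 1 / 2 ∧ r.B = m.b + c + 1 / 2 ∧ m.b ≤ m.a ∧ (r.eta = 1 ∨ r.eta = -1) ∧
    ∃ l : ℤ, r.l = l ∧ 2 * l ≤ m.a - m.b + 1 ∧ m.d = T * r.eta * (m.a - m.b + 1 - 2 * l)

theorem rep1_rexPair {c T : ℤ} {r s : Row} {m n : SRow} (hT : T = 1 ∨ T = -1)
    (hr : Rep1 c T r m) (hs : Rep1 c (T * sg (m.a - m.b)) s n) :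
    Rep1 c T (rexPair r s).1 (exch m n).1 ∧
      Rep1 c (T * sg (n.a - n.b)) (rexPair r s).2 (exch m n).2 := by
  obtain ⟨rA, rB, rl, re⟩ := r
  obtain ⟨sA, sB, sl, se⟩ := s
  obtain ⟨a, b, d⟩ := m
  obtain ⟨a', b', d'⟩ := n
  simp only [Rep1] at hr hs
  obtain ⟨rfl, rfl, hab, hre, l, rfl, hl, rfl⟩ := hr
  obtain ⟨rfl, rfl, hab', hse, l', rfl, hl', rfl⟩ := hs
  have e₁ : m1pow ((a : ℚ) + c + 1 / 2 - (b + c + 1 / 2)) = sg (a - b) := by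
    rw [← m1pow_intCast]; congr 1; push_cast; ring
  have e₂ : m1pow ((a' : ℚ) + c + 1 / 2 - (b' + c + 1 / 2)) = sg (a' - b') := by
    rw [← m1pow_intCast]; congr 1; push_cast; ring
  have e₃ : m1pow ((a : ℚ) + c + 1 / 2 - (b + c + 1 / 2) + 1) = -sg (a - b) := by
    rw [← sg_succ, ← m1pow_intCast]; congr 1; push_cast; ring
  have e₄ : m1pow ((a' : ℚ) + c + 1 / 2 - (b' + c + 1 / 2) + 1) = -sg (a' - b') := by
    rw [← sg_succ, ← m1pow_intCast]; congr 1; push_cast; ring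
  have e₅ : (b' : ℚ) + c + 1 / 2 ≤ b + c + 1 / 2 ↔ b' ≤ b := le_iff_of_sub_eq (by ring)
  have e₆ : (a : ℚ) + c + 1 / 2 ≤ a' + c + 1 / 2 ↔ a ≤ a' := le_iff_of_sub_eq (by ring)
  have e₇ : (a' : ℚ) + c + 1 / 2 - (b' + c + 1 / 2) + 1 - 2 * l' <
      2 * ((a : ℚ) + c + 1 / 2 - (b + c + 1 / 2) + 1 - 2 * l) ↔
      a' - b' + 1 - 2 * l' < 2 * (a - b + 1 - 2 * l) :=
    lt_iff_of_sub_eq (by push_cast; ring)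
  have e₈ : (a : ℚ) + c + 1 / 2 - (b + c + 1 / 2) + 1 - 2 * l <
      2 * ((a' : ℚ) + c + 1 / 2 - (b' + c + 1 / 2) + 1 - 2 * l') ↔
      a - b + 1 - 2 * l < 2 * (a' - b' + 1 - 2 * l') :=
    lt_iff_of_sub_eq (by push_cast; ring)
  simp only [rexPair, Row.subseg, Row.b, e₁, e₂, e₃, e₄, e₅, e₆, e₇, e₈]
  have h₁ := sg_eq (a - b)
  have h₂ := sg_eq (a' - b')
  generalize sg (a - b) = t at *
  generalize sg (a' - b') = t' at *
  clear e₁ e₂ e₃ e₄ e₅ e₆ e₇ e₈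
  by_cases i₁ : b' ≤ b ∧ a ≤ a'
  · have hx : ∀ u v, exch ⟨a, b, u⟩ ⟨a', b', v⟩ = (⟨a', b', 2 * u - v⟩, ⟨a, b, u⟩) :=
      fun u v => if_pos i₁
    simp only [if_pos i₁, hx]
    refine ⟨?_, ⟨rfl, rfl, hab, ?_, l, rfl, hl, ?_⟩⟩
    · split_ifs with i₂ i₃
      · refine ⟨rfl, rfl, hab', ?_, a' - b' + 1 - (l' + (a - b + 1 - 2 * l)), ?_, ?_, ?_⟩
        · rcases h₁ with rfl | rfl <;> rcases hse with rfl | rfl <;> simp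
        · push_cast; ring
        · dsimp only; omega
        · rcases h₁ with rfl | rfl <;> rcases h₂ with rfl | rfl <;> rcases hse with rfl | rfl <;>
        rcases hre with rfl | rfl <;> rcases hT with rfl | rfl <;> grind
      · refine ⟨rfl, rfl, hab', ?_, l' + (a - b + 1 - 2 * l), ?_, ?_, ?_⟩
        · rcases h₁ with rfl | rfl <;> rcases hse with rfl | rfl <;> simp
        · push_cast; ring
        · dsimp only; omega
        · rcases h₁ with rfl | rfl <;> rcases h₂ with rfl | rfl <;> rcases hse with rfl | rfl <;>
        rcases hre with rfl | rfl <;> rcases hT with rfl | rfl <;> grind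
      · refine ⟨rfl, rfl, hab', ?_, l' - (a - b + 1 - 2 * l), ?_, ?_, ?_⟩
        · rcases h₁ with rfl | rfl <;> rcases hse with rfl | rfl <;> simp
        · push_cast; ring
        · dsimp only; omega
        · rcases h₁ with rfl | rfl <;> rcases h₂ with rfl | rfl <;> rcases hse with rfl | rfl <;>
        rcases hre with rfl | rfl <;> rcases hT with rfl | rfl <;> grind
    · rcases h₂ with rfl | rfl <;> rcases hre with rfl | rfl <;> simp
    · rcases h₁ with rfl | rfl <;> rcases h₂ with rfl | rfl <;> rcases hse with rfl | rfl <;>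
        rcases hre with rfl | rfl <;> rcases hT with rfl | rfl <;> grind
  · have hx : ∀ u v, exch ⟨a, b, u⟩ ⟨a', b', v⟩ = (⟨a', b', v⟩, ⟨a, b, 2 * v - u⟩) :=
      fun u v => if_neg i₁
    simp only [if_neg i₁, hx]
    refine ⟨⟨rfl, rfl, hab', ?_, l', rfl, hl', ?_⟩, ?_⟩
    · rcases h₁ with rfl | rfl <;> rcases hse with rfl | rfl <;> simp
    · rcases h₁ with rfl | rfl <;> rcases h₂ with rfl | rfl <;> rcases hse with rfl | rfl <;>
        rcases hre with rfl | rfl <;> rcases hT with rfl | rfl <;> grind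
    · split_ifs with i₂ i₃
      · refine ⟨rfl, rfl, hab, ?_, a - b + 1 - (l + (a' - b' + 1 - 2 * l')), ?_, ?_, ?_⟩
        · rcases h₂ with rfl | rfl <;> rcases hre with rfl | rfl <;> simp
        · push_cast; ring
        · dsimp only; omega
        · rcases h₁ with rfl | rfl <;> rcases h₂ with rfl | rfl <;> rcases hse with rfl | rfl <;>
        rcases hre with rfl | rfl <;> rcases hT with rfl | rfl <;> grind
      · refine ⟨rfl, rfl, hab, ?_, l + (a' - b' + 1 - 2 * l'), ?_, ?_, ?_⟩
        · rcases h₂ with rfl | rfl <;> rcases hre with rfl | rfl <;> simp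
        · push_cast; ring
        · dsimp only; omega
        · rcases h₁ with rfl | rfl <;> rcases h₂ with rfl | rfl <;> rcases hse with rfl | rfl <;>
        rcases hre with rfl | rfl <;> rcases hT with rfl | rfl <;> grind
      · refine ⟨rfl, rfl, hab, ?_, l - (a' - b' + 1 - 2 * l'), ?_, ?_, ?_⟩
        · rcases h₂ with rfl | rfl <;> rcases hre with rfl | rfl <;> simp
        · push_cast; ring
        · dsimp only; omega
        · rcases h₁ with rfl | rfl <;> rcases h₂ with rfl | rfl <;> rcases hse with rfl | rfl <;>
        rcases hre with rfl | rfl <;> rcases hT with rfl | rfl <;> grind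

theorem xuPair_iff {c T : ℤ} {r s : Row} {m n : SRow} (hT : T = 1 ∨ T = -1)
    (hr : Rep1 c T r m) (hs : Rep1 c (T * sg (m.a - m.b)) s n) (hp : ¬ n.Prec m) :
    XuPair r s ↔ m.Lip n := by
  obtain ⟨rA, rB, rl, re⟩ := r
  obtain ⟨sA, sB, sl, se⟩ := s
  obtain ⟨a, b, d⟩ := m
  obtain ⟨a', b', d'⟩ := n
  simp only [Rep1] at hr hs
  obtain ⟨rfl, rfl, hab, hre, l, rfl, hl, rfl⟩ := hr
  obtain ⟨rfl, rfl, hab', hse, l', rfl, hl', rfl⟩ := hs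
  have e₁ : m1pow ((a : ℚ) + c + 1 / 2 - (b + c + 1 / 2)) = sg (a - b) := by
    rw [← m1pow_intCast]; congr 1; push_cast; ring
  have e₂ : (b' : ℚ) + c + 1 / 2 ≤ b + c + 1 / 2 ↔ b' ≤ b := le_iff_of_sub_eq (by ring)
  have e₃ : (a : ℚ) + c + 1 / 2 ≤ a' + c + 1 / 2 ↔ a ≤ a' := le_iff_of_sub_eq (by ring)
  have e₄ : (b : ℚ) + c + 1 / 2 ≤ b' + c + 1 / 2 ↔ b ≤ b' := le_iff_of_sub_eq (by ring)
  have e₅ : (a' : ℚ) + c + 1 / 2 ≤ a + c + 1 / 2 ↔ a' ≤ a := le_iff_of_sub_eq (by ring)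
  have e₆ : (b : ℚ) + c + 1 / 2 + l ≤ b' + c + 1 / 2 + l' ↔ b + l ≤ b' + l' :=
    le_iff_of_sub_eq (by push_cast; ring)
  have e₇ : (a : ℚ) + c + 1 / 2 - l ≤ a' + c + 1 / 2 - l' ↔ a - l ≤ a' - l' :=
    le_iff_of_sub_eq (by push_cast; ring)
  have e₈ : (a : ℚ) + c + 1 / 2 - l < b' + c + 1 / 2 + l' ↔ a - l < b' + l' :=
    lt_iff_of_sub_eq (by push_cast; ring)
  have e₉ : (0 : ℚ) ≤ l' - l ↔ l ≤ l' := by rw [sub_nonneg, Int.cast_le]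
  have e₁₀ : (0 : ℚ) ≤ l - l' ↔ l' ≤ l := by rw [sub_nonneg, Int.cast_le]
  have e₁₁ : (l' : ℚ) - l ≤ a' + c + 1 / 2 - (b' + c + 1 / 2) + 1 -
      (a + c + 1 / 2 - (b + c + 1 / 2) + 1) ↔ l' - l ≤ a' - b' - (a - b) :=
    le_iff_of_sub_eq (by push_cast; ring)
  have e₁₂ : (l : ℚ) - l' ≤ a + c + 1 / 2 - (b + c + 1 / 2) + 1 -
      (a' + c + 1 / 2 - (b' + c + 1 / 2) + 1) ↔ l - l' ≤ a - b - (a' - b') :=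
    le_iff_of_sub_eq (by push_cast; ring)
  have e₁₃ : (a : ℚ) + c + 1 / 2 - (b + c + 1 / 2) + 1 ≤ l + l' ↔ a - b + 1 ≤ l + l' :=
    le_iff_of_sub_eq (by push_cast; ring)
  have e₁₄ : (a' : ℚ) + c + 1 / 2 - (b' + c + 1 / 2) + 1 ≤ l + l' ↔ a' - b' + 1 ≤ l + l' :=
    le_iff_of_sub_eq (by push_cast; ring)
  simp only [XuPair, Row.subseg, Row.b, e₁, e₂, e₃, e₄, e₅, e₆, e₇, e₈, e₉, e₁₀, e₁₁, e₁₂, e₁₃,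
    e₁₄, Lip, Prec] at hp ⊢
  have h₁ := sg_eq (a - b)
  generalize sg (a - b) = t at *
  clear e₁ e₂ e₃ e₄ e₅ e₆ e₇ e₈ e₉ e₁₀ e₁₁ e₁₂ e₁₃ e₁₄
  rcases h₁ with rfl | rfl <;> rcases hse with rfl | rfl <;> rcases hre with rfl | rfl <;>
    rcases hT with rfl | rfl <;> simp <;> omega

/-- `F` is the list of signed rows of `E`, shifted by `c`, with initial sign `T`. -/
inductive Rep (c : ℤ) : ℤ → List Row → List SRow → Prop
  | nil (T : ℤ) : Rep c T [] []
  | cons {T : ℤ} {r : Row} {m : SRow} {E : List Row} {F : List SRow} :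
      Rep1 c T r m → Rep c (T * sg (m.a - m.b)) E F → Rep c T (r :: E) (m :: F)

/-- The sign contributed by a list of rows to the rows following it. -/
def tw (F : List SRow) : ℤ := (F.map fun m => sg (m.a - m.b)).prod

@[simp] theorem tw_nil : tw [] = 1 := rfl

@[simp] theorem tw_cons (m : SRow) (F : List SRow) : tw (m :: F) = sg (m.a - m.b) * tw F := by
  simp [tw]

@[simp] theorem tw_append (F G : List SRow) : tw (F ++ G) = tw F * tw G := by simp [tw]

theorem sign_mul {x y : ℤ} (hx : x = 1 ∨ x = -1) (hy : y = 1 ∨ y = -1) :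
    x * y = 1 ∨ x * y = -1 := by
  rcases hx with rfl | rfl <;> rcases hy with rfl | rfl <;> simp

theorem tw_eq (F : List SRow) : tw F = 1 ∨ tw F = -1 := by
  induction F with
  | nil => simp
  | cons m F ih => rw [tw_cons]; exact sign_mul (sg_eq _) ih

theorem Rep.length_eq {c T : ℤ} {E : List Row} {F : List SRow} (h : Rep c T E F) :
    E.length = F.length := by
  induction h with
  | nil => rfl
  | cons _ _ ih => simp [ih]

theorem Rep.append {c T : ℤ} {E₁ E₂ : List Row} {F₁ F₂ : List SRow} (h₁ : Rep c T E₁ F₁)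
    (h₂ : Rep c (T * tw F₁) E₂ F₂) : Rep c T (E₁ ++ E₂) (F₁ ++ F₂) := by
  induction h₁ with
  | nil T => simpa using h₂
  | cons h _ ih => exact .cons h (ih (by simpa [mul_assoc] using h₂))

theorem Rep.exists_append {c T : ℤ} {E : List Row} {F₁ F₂ : List SRow}
    (h : Rep c T E (F₁ ++ F₂)) :
    ∃ E₁ E₂, E = E₁ ++ E₂ ∧ Rep c T E₁ F₁ ∧ Rep c (T * tw F₁) E₂ F₂ := by
  induction F₁ generalizing T E with
  | nil => exact ⟨[], E, rfl, .nil _, by simpa using h⟩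
  | cons m F ih =>
    cases h with
    | cons h₁ h₂ =>
      obtain ⟨E₁, E₂, rfl, h₃, h₄⟩ := ih h₂
      exact ⟨_ :: E₁, E₂, rfl, .cons h₁ h₃, by simpa [mul_assoc] using h₄⟩

theorem Rep.exists_mem {c T : ℤ} {E : List Row} {F : List SRow} (h : Rep c T E F)
    (hT : T = 1 ∨ T = -1) {r : Row} (hr : r ∈ E) :
    ∃ m ∈ F, ∃ T', (T' = 1 ∨ T' = -1) ∧ Rep1 c T' r m := by
  induction h with
  | nil => simp at hr
  | cons h₁ _ ih =>
    rcases List.mem_cons.1 hr with rfl | hr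
    · exact ⟨_, List.mem_cons_self, _, hT, h₁⟩
    · obtain ⟨m, hm, h⟩ := ih (sign_mul hT (sg_eq _)) hr
      exact ⟨m, List.mem_cons_of_mem _ hm, h⟩

theorem Rep.exists_mem_right {c T : ℤ} {E : List Row} {F : List SRow} (h : Rep c T E F)
    (hT : T = 1 ∨ T = -1) {m : SRow} (hm : m ∈ F) :
    ∃ r ∈ E, ∃ T', (T' = 1 ∨ T' = -1) ∧ Rep1 c T' r m := by
  induction h with
  | nil => simp at hm
  | cons h₁ _ ih =>
    rcases List.mem_cons.1 hm with rfl | hm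
    · exact ⟨_, List.mem_cons_self, _, hT, h₁⟩
    · obtain ⟨r, hr, h⟩ := ih (sign_mul hT (sg_eq _)) hm
      exact ⟨r, List.mem_cons_of_mem _ hr, h⟩

/-! ### Row exchanges and Xu's conditions on signed rows -/

theorem rex_succ (k : ℕ) (t : Row) (E : List Row) : rex (k + 1) (t :: E) = t :: rex k E := by
  simp only [rex, List.getElem?_cons_succ, List.take_succ_cons, List.drop_succ_cons]
  split
  · split_ifs <;> simp [*]
  · simp [*]

theorem rex_zero (r s : Row) (E : List Row) :
    rex 0 (r :: s :: E) =
      if r.subseg s ∨ s.subseg r then (rexPair r s).1 :: (rexPair r s).2 :: E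
      else r :: s :: E := by
  simp [rex]

theorem Rep1.subseg_iff {c T T' : ℤ} {r s : Row} {m n : SRow} (hr : Rep1 c T r m)
    (hs : Rep1 c T' s n) : r.subseg s ↔ m.Inside n := by
  unfold Row.subseg Inside
  rw [hr.1, hr.2.1, hs.1, hs.2.1]
  exact and_congr (le_iff_of_sub_eq (by ring)) (le_iff_of_sub_eq (by ring))

theorem Rep.exchange {c T : ℤ} {r s : Row} {m n : SRow} {E : List Row} {F : List SRow}
    (hT : T = 1 ∨ T = -1) (h : Rep c T (r :: s :: E) (m :: n :: F)) :
    Rep c T ((rexPair r s).1 :: (rexPair r s).2 :: E) ((exch m n).1 :: (exch m n).2 :: F) := by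
  cases h with
  | cons h₁ h₂ => cases h₂ with
    | cons h₂ h₃ =>
      obtain ⟨h₄, h₅⟩ := rep1_rexPair hT h₁ h₂
      refine .cons h₄ (.cons (by simpa using h₅) ?_)
      simpa [mul_right_comm] using h₃

theorem Rep.exists_rex {c T : ℤ} {E : List Row} {F : List SRow} (hT : T = 1 ∨ T = -1)
    (h : Rep c T E F) (k : ℕ) :
    ∃ F', Relation.ReflTransGen SStep F F' ∧ Rep c T (rex k E) F' := by
  induction k generalizing T E F with
  | zero =>
    cases h with
    | nil => exact ⟨_, .refl, by simpa [rex] using Rep.nil T⟩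
    | cons h₁ h₂ =>
      cases h₂ with
      | nil => exact ⟨_, .refl, by simpa [rex] using Rep.cons h₁ (.nil _)⟩
      | cons h₂ h₃ =>
        have hi := or_congr (h₁.subseg_iff h₂) (h₂.subseg_iff h₁)
        rw [rex_zero]
        split_ifs with i
        · exact ⟨_, .single (.head _ _ _ (hi.1 i)), Rep.exchange hT (.cons h₁ (.cons h₂ h₃))⟩
        · exact ⟨_, .refl, .cons h₁ (.cons h₂ h₃)⟩
  | succ k ih =>
    cases h with
    | nil => exact ⟨_, .refl, by simpa [rex] using Rep.nil T⟩
    | cons h₁ h₂ =>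
      obtain ⟨F', h₃, h₄⟩ := ih (sign_mul hT (sg_eq _)) h₂
      refine ⟨_ :: F', ?_, by rw [rex_succ]; exact .cons h₁ h₄⟩
      exact Relation.ReflTransGen.lift (List.cons _) (fun _ _ h => SStep.cons _ h) _ _ h₃

theorem Rep.sstep {c T : ℤ} {E : List Row} {F F' : List SRow} (hT : T = 1 ∨ T = -1)
    (h : Rep c T E F) (hF : SStep F F') : ∃ k, Rep c T (rex k E) F' := by
  induction hF generalizing T E with
  | head m n F i =>
    cases h with
    | cons h₁ h₂ => cases h₂ with
      | cons h₂ h₃ =>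
        refine ⟨0, ?_⟩
        rw [rex_zero, if_pos ((or_congr (h₁.subseg_iff h₂) (h₂.subseg_iff h₁)).2 i)]
        exact Rep.exchange hT (.cons h₁ (.cons h₂ h₃))
  | cons m _ ih =>
    cases h with
    | cons h₁ h₂ =>
      obtain ⟨k, hk⟩ := ih (sign_mul hT (sg_eq _)) h₂
      exact ⟨k + 1, by rw [rex_succ]; exact .cons h₁ hk⟩

theorem Rep.reorder {c T : ℤ} {E E' : List Row} {F : List SRow} (hT : T = 1 ∨ T = -1)
    (h : Rep c T E F) (hE : Reorder E E') :
    ∃ F', Relation.ReflTransGen SStep F F' ∧ Rep c T E' F' := by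
  induction hE with
  | refl => exact ⟨F, .refl, h⟩
  | tail _ hs ih =>
    obtain ⟨F', h₁, h₂⟩ := ih
    obtain ⟨k, rfl⟩ := hs
    obtain ⟨F'', h₃, h₄⟩ := h₂.exists_rex hT k
    exact ⟨F'', h₁.trans h₃, h₄⟩

theorem Rep.exists_reorder {c T : ℤ} {E : List Row} {F F' : List SRow} (hT : T = 1 ∨ T = -1)
    (h : Rep c T E F) (hF : Relation.ReflTransGen SStep F F') :
    ∃ E', Reorder E E' ∧ Rep c T E' F' := by
  induction hF with
  | refl => exact ⟨E, .refl, h⟩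
  | tail _ hs ih =>
    obtain ⟨E', h₁, h₂⟩ := ih
    obtain ⟨k, hk⟩ := h₂.sstep hT hs
    exact ⟨_, h₁.tail ⟨k, rfl⟩, hk⟩

theorem Adm.reorder {F F' : List SRow} (h : Adm F) (hF : Relation.ReflTransGen SStep F F') :
    Adm F' := by
  induction hF with
  | refl => exact h
  | tail _ hs ih => exact ih.sstep hs

theorem Rep.xuAll_iff {c T : ℤ} {E : List Row} {F : List SRow} (hT : T = 1 ∨ T = -1)
    (h : Rep c T E F) (hF : Adm F) : XuAll E ↔ LipChain F := by
  change E.IsChain XuPair ↔ F.IsChain Lip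
  induction h with
  | nil => simp
  | cons h₁ h₂ ih =>
    have ih := ih (sign_mul hT (sg_eq _)) (List.pairwise_cons.1 hF).2
    cases h₂ with
    | nil => simp
    | cons h₂ h₃ =>
      have hp := (List.pairwise_cons.1 hF).1 _ List.mem_cons_self
      rw [List.isChain_cons_cons, List.isChain_cons_cons, ih, xuPair_iff hT h₁ h₂ hp]

theorem Rep.shift {c T : ℤ} {E : List Row} {F : List SRow} (h : Rep c T E F) (d : ℤ) :
    Rep (c + d) T (shAll d E) F := by
  induction h with
  | nil => exact .nil _
  | cons h₁ _ ih =>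
    refine .cons ?_ ih
    obtain ⟨hA, hB, h⟩ := h₁
    exact ⟨by simp only [Row.sh, hA]; push_cast; ring,
      by simp only [Row.sh, hB]; push_cast; ring, h⟩

/-- Xu's conditions on all shifts and reorderings of `E`, in terms of signed rows. -/
theorem Rep.xuAll_reorder_iff {c T : ℤ} {E : List Row} {F : List SRow} (hT : T = 1 ∨ T = -1)
    (h : Rep c T E F) (hF : Adm F) :
    (∀ d : ℕ, (∀ r ∈ E, 0 ≤ r.B + (d : ℚ)) → ∀ G, Reorder (shAll d E) G → XuAll G) ↔
      LipReorder F := by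
  constructor
  · intro H F' hF'
    obtain ⟨d, hd⟩ : ∃ d : ℕ, ∀ r ∈ E, 0 ≤ r.B + (d : ℚ) := by
      clear h H
      induction E with
      | nil => exact ⟨0, by simp⟩
      | cons r E ih =>
        obtain ⟨d, hd⟩ := ih
        obtain ⟨n, hn⟩ := exists_nat_ge (-r.B)
        refine ⟨d + n, fun s hs => ?_⟩
        push_cast
        rcases List.mem_cons.1 hs with rfl | hs
        · have : (0 : ℚ) ≤ d := by positivity
          linarith
        · have : (0 : ℚ) ≤ n := by positivity
          have := hd s hs
          linarith
    obtain ⟨G, hG, hGF⟩ := (h.shift d).exists_reorder hT hF'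
    exact (hGF.xuAll_iff hT (hF.reorder hF')).1 (H d hd G hG)
  · intro H d _ G hG
    obtain ⟨F', hF', hGF⟩ := (h.shift d).reorder hT hG
    exact (hGF.xuAll_iff hT (hF.reorder hF')).2 (H F' hF')

/-! ### Properties of symbols in terms of signed rows -/

theorem isInt_iff {x : ℚ} : IsInt x ↔ ∃ n : ℤ, x = n :=
  ⟨fun h => ⟨x.num, (Rat.coe_int_num_of_den_eq_one h).symm⟩,
    by rintro ⟨n, rfl⟩; exact Rat.den_intCast n⟩

theorem not_isInt_add_half (n : ℤ) : ¬ IsInt (n + 1 / 2 : ℚ) := by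
  rw [isInt_iff]
  rintro ⟨m, hm⟩
  have : ((2 * n + 1 : ℤ) : ℚ) = (2 * m : ℤ) := by push_cast; linarith
  have := Int.cast_injective this
  omega

theorem Rep1.exists_of_isES (T : ℤ) {r : Row} (h : r.IsES) (hl : r.l ≤ r.b / 2) {n : ℤ}
    (hA : r.A = n + 1 / 2) : ∃ m, Rep1 0 T r m := by
  obtain ⟨-, -, ⟨j, hj⟩, hl', he⟩ := h
  obtain ⟨l, hl'⟩ := isInt_iff.1 hl'
  refine ⟨⟨n, n - j, T * r.eta * (j + 1 - 2 * l)⟩, by simp [hA], ?_, by simp, he, l, hl', ?_, ?_⟩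
  · push_cast; linarith
  · have : ((2 * l : ℤ) : ℚ) ≤ (j + 1 : ℤ) := by
      push_cast
      rw [hl', Row.b, hj] at hl
      linarith
    have := Int.cast_le.1 this
    dsimp only
    omega
  · simp

theorem Rep.exists_of_isES (T : ℤ) {E : List Row}
    (h : ∀ r ∈ E, r.IsES ∧ r.l ≤ r.b / 2 ∧ ∃ n : ℤ, r.A = n + 1 / 2) : ∃ F, Rep 0 T E F := by
  induction E generalizing T with
  | nil => exact ⟨[], .nil _⟩
  | cons r E ih =>
    obtain ⟨h₁, h₂, n, hn⟩ := h r List.mem_cons_self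
    obtain ⟨m, hm⟩ := Rep1.exists_of_isES T h₁ h₂ hn
    obtain ⟨F, hF⟩ := ih (T * sg (m.a - m.b)) fun s hs => h s (List.mem_cons_of_mem _ hs)
    exact ⟨m :: F, .cons hm hF⟩

theorem Rep.pairwise_iff {c T : ℤ} {E : List Row} {F : List SRow} {R : Row → Row → Prop}
    {S : SRow → SRow → Prop} (h : Rep c T E F) (hT : T = 1 ∨ T = -1)
    (hRS : ∀ {T₁ T₂ r s m n}, Rep1 c T₁ r m → Rep1 c T₂ s n → (R r s ↔ S m n)) :
    E.Pairwise R ↔ F.Pairwise S := by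
  induction h with
  | nil => simp
  | @cons T _ m _ _ h₁ h₂ ih =>
    have hT' := sign_mul hT (sg_eq (m.a - m.b))
    rw [List.pairwise_cons, List.pairwise_cons, ih hT']
    refine and_congr_left fun _ => ⟨fun h n hn => ?_, fun h s hs => ?_⟩
    · obtain ⟨s, hs, _, _, h₃⟩ := h₂.exists_mem_right hT' hn
      exact (hRS h₁ h₃).1 (h s hs)
    · obtain ⟨n, hn, _, _, h₃⟩ := h₂.exists_mem hT' hs
      exact (hRS h₁ h₃).2 (h n hn)

theorem Rep.pprime_iff {c T : ℤ} {E : List Row} {F : List SRow} (h : Rep c T E F)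
    (hT : T = 1 ∨ T = -1) : Pprime E ↔ F.Pairwise fun m n => m.b ≤ n.b :=
  h.pairwise_iff hT fun h₁ h₂ => le_iff_of_sub_eq (by rw [h₁.2.1, h₂.2.1]; ring)

theorem Rep.adm_iff {c T : ℤ} {E : List Row} {F : List SRow} (h : Rep c T E F)
    (hT : T = 1 ∨ T = -1) :
    E.Pairwise (fun r s => ¬ (s.A < r.A ∧ s.B < r.B)) ↔ Adm F :=
  h.pairwise_iff hT fun h₁ h₂ => not_congr <| and_congr
    (lt_iff_of_sub_eq (by rw [h₁.1, h₂.1]; ring)) (lt_iff_of_sub_eq (by rw [h₁.2.1, h₂.2.1]; ring))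

theorem Rep.isEMS {T : ℤ} {E : List Row} {F : List SRow} (h : Rep 0 T E F)
    (hT : T = 1 ∨ T = -1) (hF : Adm F)
    (hd : ∀ m ∈ F, 0 ≤ m.a + m.b + 1 ∧ (m.d.natAbs : ℤ) ≤ m.a - m.b + 1) : IsEMS E := by
  refine ⟨⟨fun r hr => ?_, fun r hr => ?_, fun r hr s hs => ?_, (h.adm_iff hT).2 hF⟩,
    fun r hr => ?_⟩
  · obtain ⟨m, hm, T', hT', hA, hB, hab, he, l, hl, -⟩ := h.exists_mem hT hr
    refine ⟨isInt_iff.2 ⟨2 * m.a + 1, by rw [hA]; push_cast; ring⟩,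
      isInt_iff.2 ⟨2 * m.b + 1, by rw [hB]; push_cast; ring⟩, ⟨(m.a - m.b).toNat, ?_⟩,
      isInt_iff.2 ⟨l, hl⟩, he⟩
    rw [hA, hB, ← Int.cast_natCast, Int.toNat_of_nonneg (by omega)]
    push_cast; ring
  · obtain ⟨m, hm, T', hT', hA, hB, -⟩ := h.exists_mem hT hr
    have : r.A + r.B = ((m.a + m.b + 1 : ℤ) : ℚ) := by rw [hA, hB]; push_cast; ring
    rw [this]
    exact_mod_cast (hd m hm).1
  · obtain ⟨m, hm, T', hT', hA, hB, -⟩ := h.exists_mem hT hr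
    obtain ⟨n, hn, T'', hT'', hA', hB', -⟩ := h.exists_mem hT hs
    exact isInt_iff.2 ⟨m.a - n.a, by rw [hA, hA']; push_cast; ring⟩
  · obtain ⟨m, hm, T', hT', hA, hB, hab, he, l, hl, hl', hd'⟩ := h.exists_mem hT hr
    have h₁ := (hd m hm).2
    have h₂ : (m.d.natAbs : ℤ) = m.a - m.b + 1 - 2 * l := by
      rw [hd']
      rcases hT' with rfl | rfl <;> rcases he with he | he <;> rw [he] <;> omega
    refine ⟨by rw [hl]; exact_mod_cast (by omega : 0 ≤ l), ?_⟩
    have : ((2 * l : ℤ) : ℚ) ≤ (m.a - m.b + 1 : ℤ) := by exact_mod_cast hl'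
    push_cast at this
    rw [hl, Row.b, hA, hB]
    linarith

theorem Rep.bounds_of_isEMS {T : ℤ} {E : List Row} {F : List SRow} (h : Rep 0 T E F)
    (hT : T = 1 ∨ T = -1) (hE : IsEMS E) :
    ∀ m ∈ F, 0 ≤ m.a + m.b + 1 ∧ (m.d.natAbs : ℤ) ≤ m.a - m.b + 1 := by
  intro m hm
  obtain ⟨r, hr, T', hT', hA, hB, hab, he, l, hl, hl', hd'⟩ := h.exists_mem_right hT hm
  constructor
  · have h₁ := hE.1.2.1 r hr
    have : r.A + r.B = ((m.a + m.b + 1 : ℤ) : ℚ) := by rw [hA, hB]; push_cast; ring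
    rw [this] at h₁
    exact_mod_cast h₁
  · have h₁ := (hE.2 r hr).1
    rw [hl] at h₁
    have h₁ : 0 ≤ l := by exact_mod_cast h₁
    rw [hd']
    rcases hT' with rfl | rfl <;> rcases he with he | he <;> rw [he] <;> omega

theorem Rep1.equiv {c T : ℤ} {r s : Row} {m : SRow} (hT : T = 1 ∨ T = -1) (hr : Rep1 c T r m)
    (hs : Rep1 c T s m) : r.Equiv s := by
  obtain ⟨hA, hB, hab, he, l, hl, hl', hd⟩ := hr
  obtain ⟨hA', hB', -, he', l', hl₁, hl₁', hd'⟩ := hs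
  have h : l = l' ∧ (r.eta = s.eta ∨ 2 * l = m.a - m.b + 1) := by
    rw [hd] at hd'
    rcases hT with rfl | rfl <;> rcases he with he | he <;> rcases he' with he' | he' <;>
      rw [he, he'] at hd' ⊢ <;> omega
  refine ⟨hA.trans hA'.symm, hB.trans hB'.symm, by rw [hl, hl₁, h.1], h.2.imp_right fun h => ?_⟩
  have : ((2 * l : ℤ) : ℚ) = (m.a - m.b + 1 : ℤ) := by rw [h]
  push_cast at this
  rw [hl, Row.b, hA, hB]
  linarith

theorem Rep.symEquiv {c T : ℤ} {E E' : List Row} {F : List SRow} (hT : T = 1 ∨ T = -1)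
    (h : Rep c T E F) (h' : Rep c T E' F) : SymEquiv E E' := by
  unfold SymEquiv
  induction h generalizing E' with
  | nil => cases h'; exact .nil
  | cons h₁ _ ih =>
    cases h' with
    | cons h₂ h₃ => exact .cons (h₁.equiv hT h₂) (ih (sign_mul hT (sg_eq _)) h₃)

/-! ### The sums of the `a_i` and of the `b_i` -/

theorem Rep.exists_append_left {c T : ℤ} {E₁ E₂ : List Row} {F : List SRow}
    (h : Rep c T (E₁ ++ E₂) F) :
    ∃ F₁ F₂, F = F₁ ++ F₂ ∧ Rep c T E₁ F₁ ∧ Rep c (T * tw F₁) E₂ F₂ := by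
  induction E₁ generalizing T F with
  | nil => exact ⟨[], F, rfl, .nil _, by simpa using h⟩
  | cons r E ih =>
    cases h with
    | cons h₁ h₂ =>
      obtain ⟨F₁, F₂, rfl, h₃, h₄⟩ := ih h₂
      exact ⟨_ :: F₁, F₂, rfl, .cons h₁ h₃, by simpa [mul_assoc] using h₄⟩

theorem Rep.exists_sum_a {T : ℤ} {E : List Row} {F : List SRow} (h : Rep 0 T E F) :
    ∃ α : ℤ, (E.map Row.a).sum = α ∧ sg α = tw F := by
  induction h with
  | nil => exact ⟨0, by simp, rfl⟩
  | @cons T r m E F h₁ _ ih =>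
    obtain ⟨α, hα, h⟩ := ih
    refine ⟨m.a + m.b + 2 + α, ?_, ?_⟩
    · rw [List.map_cons, List.sum_cons, hα, Row.a, h₁.1, h₁.2.1]; push_cast; ring
    · rw [tw_cons, sg_add, h, sg_congr (m := m.a + m.b + 2) (n := m.a - m.b) (by omega)]

theorem Rep.m1pow_sum_a {T : ℤ} {E : List Row} {F : List SRow} (h : Rep 0 T E F) :
    m1pow (E.map Row.a).sum = tw F := by
  obtain ⟨α, h₁, h₂⟩ := h.exists_sum_a
  rw [h₁, m1pow_intCast, h₂]

theorem alphaAt_append (E₁ E₂ : List Row) :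
    alphaAt (E₁ ++ E₂) E₁.length = (E₁.map Row.a).sum := by
  simp [alphaAt]

theorem betaAt_append (E₁ E₂ : List Row) (r : Row) :
    betaAt (E₁ ++ r :: E₂) E₁.length = (E₂.map Row.b).sum := by
  simp [betaAt]

theorem eq_append_of_getElem? {α : Type*} {L : List α} {i : ℕ} {x : α} (h : L[i]? = some x) :
    ∃ L₁ L₂, L = L₁ ++ x :: L₂ ∧ L₁.length = i := by
  obtain ⟨hi, rfl⟩ := List.getElem?_eq_some_iff.1 h
  exact ⟨L.take i, L.drop (i + 1), by simp, by simp; omega⟩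

theorem Rep1.star_iff {T : ℤ} {r : Row} {m : SRow} (hT : T = 1 ∨ T = -1) (h : Rep1 0 T r m)
    (hm : 0 ≤ m.a + m.b + 1) :
    ((IsInt r.B → 0 ≤ r.B + r.l) ∧
      (¬ IsInt r.B → r.eta = - T → (1 / 2 : ℚ) ≤ r.B + r.l) ∧
      (¬ IsInt r.B → r.eta = T → -(1 / 2 : ℚ) ≤ r.B + r.l)) ↔
      ((m.d - 1).natAbs : ℤ) ≤ m.a + m.b + 2 := by
  obtain ⟨hA, hB, hab, he, l, hl, hl', hd⟩ := h
  have hB' : r.B = m.b + 1 / 2 := by simpa using hB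
  have hn : ¬ IsInt r.B := hB' ▸ not_isInt_add_half m.b
  have e₁ : (1 / 2 : ℚ) ≤ r.B + r.l ↔ -m.b ≤ l :=
    le_iff_of_sub_eq (by rw [hB', hl]; push_cast; ring)
  have e₂ : -(1 / 2 : ℚ) ≤ r.B + r.l ↔ -1 - m.b ≤ l :=
    le_iff_of_sub_eq (by rw [hB', hl]; push_cast; ring)
  simp only [hn, e₁, e₂, false_imp_iff, not_false_iff, true_imp_iff, true_and, hd]
  rcases hT with rfl | rfl <;> rcases he with he | he <;> grind

theorem Rep.starCond_iff {E : List Row} {F : List SRow} (h : Rep 0 1 E F)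
    (hF : ∀ m ∈ F, 0 ≤ m.a + m.b + 1) :
    StarCond E ↔ ∀ m ∈ F, ((m.d - 1).natAbs : ℤ) ≤ m.a + m.b + 2 := by
  constructor
  · intro H m hm
    obtain ⟨F₁, F₂, rfl⟩ := List.append_of_mem hm
    obtain ⟨E₁, E₂, rfl, h₁, h₂⟩ := h.exists_append
    cases h₂ with
    | @cons _ r _ E₂ _ h₂ h₃ =>
      have := H E₁.length r (by simp)
      rw [alphaAt_append, h₁.m1pow_sum_a] at this
      rw [one_mul] at h₂
      exact (h₂.star_iff (tw_eq F₁) (hF m hm)).1 this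
  · intro H i r hr
    obtain ⟨E₁, E₂, rfl, rfl⟩ := eq_append_of_getElem? hr
    obtain ⟨F₁, F₂, rfl, h₁, h₂⟩ := h.exists_append_left
    cases h₂ with
    | @cons _ _ m _ F₂ h₂ h₃ =>
      rw [alphaAt_append, h₁.m1pow_sum_a]
      rw [one_mul] at h₂
      exact (h₂.star_iff (tw_eq F₁) (hF m (by simp))).2 (H m (by simp))

/-! ### Duals -/

/-- Atobe's dual on signed rows. -/
def SRow.adual (m : SRow) : SRow := ⟨m.a, -1 - m.b, 1 - m.d⟩

theorem adual_adual (m : SRow) : m.adual.adual = m := by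
  ext <;> simp [SRow.adual]

@[simp] theorem tw_reverse (F : List SRow) : tw F.reverse = tw F := by
  simp [tw, List.prod_reverse]

@[simp] theorem tw_map_mirror (c : ℤ) (F : List SRow) : tw (F.map (mirror c)) = tw F := by
  simp [tw, mirror, Function.comp_def]

theorem Rep.exists_sum_b {T : ℤ} {E : List Row} {F : List SRow} (h : Rep 0 T E F) :
    ∃ β : ℤ, (E.map Row.b).sum = β ∧ sg β = tw (F.map SRow.adual) := by
  induction h with
  | nil => exact ⟨0, by simp, rfl⟩
  | @cons T r m E F h₁ _ ih =>
    obtain ⟨β, hβ, h⟩ := ih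
    refine ⟨m.a - m.b + 1 + β, ?_, ?_⟩
    · rw [List.map_cons, List.sum_cons, hβ, Row.b, h₁.1, h₁.2.1]; push_cast; ring
    · rw [List.map_cons, tw_cons, sg_add, h]
      congr 1
      exact sg_congr (by simp only [SRow.adual]; omega)

theorem Rep1.dualRow {T T' : ℤ} {r : Row} {m : SRow} {E : List Row} {i : ℕ} {α β : ℤ}
    (h : Rep1 0 T r m) (hm : 0 ≤ m.a + m.b + 1) (hα : alphaAt E i = α) (hβ : betaAt E i = β)
    (hT : sg α = T) (hT' : sg β = T') : Rep1 0 T' (dualRow E i r) m.adual := by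
  obtain ⟨rA, rB, rl, re⟩ := r
  obtain ⟨a, b, d⟩ := m
  simp only [Rep1] at h
  obtain ⟨rfl, rfl, hab, he, l, rfl, hl, rfl⟩ := h
  have hn : ¬ IsInt ((b : ℚ) + (0 : ℤ) + 1 / 2) := by simpa using not_isInt_add_half b
  have e₁ : (l : ℚ) = (a + (0 : ℤ) + 1 / 2 - (b + (0 : ℤ) + 1 / 2) + 1) / 2 ↔
      2 * l = a - b + 1 := by
    rw [eq_div_iff two_ne_zero, ← Int.cast_inj (α := ℚ)]
    push_cast
    constructor <;> intro h <;> linarith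
  have e₂ : m1pow ((α : ℚ) + β) = T * T' := by
    rw [← hT, ← hT', ← sg_add, ← m1pow_intCast]; push_cast; rfl
  have s₁ := hT ▸ sg_eq α
  have s₂ := hT' ▸ sg_eq β
  simp only [LocalArthur.dualRow, hα, hβ, hn, Row.b, not_false_iff, true_and, if_false, e₁, e₂,
    m1pow_intCast, hT, SRow.adual]
  have key : ∀ η : ℤ, (η = 1 ∨ η = -1) → (2 * l = a - b + 1 → η = -T) →
      (2 * l ≠ a - b + 1 → η = re) →
      Rep1 0 T' ⟨(a : ℚ) + (0 : ℤ) + 1 / 2, -((b : ℚ) + (0 : ℤ) + 1 / 2),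
        (l : ℚ) + (b + (0 : ℤ) + 1 / 2) + ((T * η : ℤ) : ℚ) / 2, -(T * T' * η)⟩
        ⟨a, -1 - b, 1 - T * re * (a - b + 1 - 2 * l)⟩ := by
    intro η hη h₁ h₂
    refine ⟨rfl, by push_cast; ring, by dsimp only at *; omega, ?_,
      l + b + (1 + T * η) / 2, ?_, ?_, ?_⟩
    · rcases s₁ with rfl | rfl <;> rcases s₂ with rfl | rfl <;> rcases hη with rfl | rfl <;> simp
    · rcases s₁ with rfl | rfl <;> rcases hη with rfl | rfl <;> norm_num <;> ring
    · rcases s₁ with rfl | rfl <;> rcases hη with rfl | rfl <;> grind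
    · rcases s₁ with rfl | rfl <;> rcases s₂ with rfl | rfl <;> rcases hη with rfl | rfl <;>
        rcases he with rfl | rfl <;> grind
  split_ifs with i
  · exact key _ (by rcases s₁ with h | h <;> simp [h]) (fun _ => rfl) (absurd i)
  · exact key _ he (fun h => absurd h i) fun _ => rfl

theorem Rep.dualRow_mapIdx {T : ℤ} {E₂ : List Row} {F₂ : List SRow} (h₂ : Rep 0 T E₂ F₂)
    (hm : ∀ m ∈ F₂, 0 ≤ m.a + m.b + 1) {E₁ : List Row} {F₁ : List SRow} (h₁ : Rep 0 1 E₁ F₁)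
    (hT : T = tw F₁) :
    Rep 0 1 (E₂.mapIdx fun i r => dualRow (E₁ ++ E₂) (i + E₁.length) r).reverse
      (F₂.map SRow.adual).reverse := by
  induction h₂ generalizing E₁ F₁ with
  | nil => exact .nil _
  | @cons T r m E₂ F₂ h h₂ ih =>
    have ih := ih (fun n hn => hm n (List.mem_cons_of_mem _ hn)) (E₁ := E₁ ++ [r])
      (F₁ := F₁ ++ [m]) (h₁.append (.cons (by rwa [one_mul, ← hT]) (.nil _))) (by simp [hT])
    rw [List.mapIdx_cons, List.reverse_cons, List.map_cons, List.reverse_cons]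
    refine Rep.append ?_ (.cons ?_ (.nil _))
    · simpa [add_assoc, add_comm, add_left_comm] using ih
    · obtain ⟨α, hα, hα'⟩ := h₁.exists_sum_a
      obtain ⟨β, hβ, hβ'⟩ := h₂.exists_sum_b
      refine h.dualRow (hm m List.mem_cons_self) (α := α) (β := β) ?_ ?_ (hα'.trans hT.symm) ?_
      · rw [zero_add, alphaAt_append, hα]
      · rw [zero_add, betaAt_append, hβ]
      · rw [one_mul, tw_reverse, hβ']

theorem Rep.dual {E : List Row} {F : List SRow} (h : Rep 0 1 E F)
    (hm : ∀ m ∈ F, 0 ≤ m.a + m.b + 1) : Rep 0 1 (dual E) (F.map SRow.adual).reverse := by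
  simpa [LocalArthur.dual] using h.dualRow_mapIdx hm (E₁ := []) (.nil _) rfl

theorem Rep.neg {c T : ℤ} {E : List Row} {F : List SRow} (h : Rep c T E F) :
    Rep c (-T) E (F.map (mirror 0)) := by
  induction h with
  | nil => exact .nil _
  | cons h₁ _ ih =>
    obtain ⟨hA, hB, hab, he, l, hl, hl', hd⟩ := h₁
    exact .cons ⟨hA, hB, hab, he, l, hl, hl', by simp [mirror, hd]⟩ (by simpa [mirror] using ih)

theorem Rep.b_le_a {T : ℤ} {c : ℤ} {E : List Row} {F : List SRow} (h : Rep c T E F) :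
    ∀ m ∈ F, m.b ≤ m.a := by
  induction h with
  | nil => simp
  | cons h _ ih => exact List.forall_mem_cons.2 ⟨h.2.2.1, ih⟩

theorem Rep.dualPlus {K : ℤ} {E : List Row} {F₁ F₂ : List SRow}
    (h : Rep 0 1 E (F₁ ++ ⟨K, 0, -(K + 1)⟩ :: F₂))
    (hm : ∀ m ∈ F₁ ++ ⟨K, 0, -(K + 1)⟩ :: F₂, 0 ≤ m.a + m.b + 1) :
    Rep 0 1 (dualPlus F₁.length E) (pdual K F₁ F₂) := by
  have hd := h.dual hm
  obtain ⟨E₁, E₂, rfl, h₁, h₂⟩ := h.exists_append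
  rw [one_mul] at h₂
  obtain ⟨rk, E₂, rfl, hk, h₂⟩ : ∃ r E₂', E₂ = r :: E₂' ∧ Rep1 0 (tw F₁) r ⟨K, 0, -(K + 1)⟩ ∧
      Rep 0 (tw F₁ * sg K) E₂' F₂ := by
    cases h₂ with
    | cons h₂ h₃ => exact ⟨_, _, rfl, h₂, by simpa using h₃⟩
  obtain ⟨hA, hB, hK, he, l, hl, hl', hd'⟩ := hk
  dsimp only at hA hB hK hl' hd'
  have hl₀ : l = 0 ∧ tw F₁ * rk.eta = -1 := by
    rcases tw_eq F₁ with ht | ht <;> rcases he with he | he <;> rw [ht, he] at hd' ⊢ <;> omega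
  rw [List.map_append, List.reverse_append, List.map_cons, List.reverse_cons,
    List.append_assoc] at hd
  obtain ⟨G₂, G₁, hG, hG₂, hG₁⟩ := hd.exists_append
  rw [one_mul] at hG₁
  obtain ⟨U, hU⟩ : ∃ U, U = tw (F₂.map SRow.adual).reverse := ⟨_, rfl⟩
  rw [← hU] at hG₁
  obtain ⟨g, G₁, rfl, hG₃⟩ : ∃ g G₁', G₁ = g :: G₁' ∧
      Rep 0 (U * sg (K + 1)) G₁' (F₁.map SRow.adual).reverse := by
    cases hG₁ with
    | cons _ h₃ => exact ⟨_, _, rfl, by simpa [SRow.adual] using h₃⟩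
  obtain ⟨s, hs⟩ : ∃ s, s = -m1pow (gammaAt (E₁ ++ rk :: E₂) F₁.length) := ⟨_, rfl⟩
  have hs' : s = 1 ∨ s = -1 := by rw [hs]; unfold m1pow; split_ifs <;> simp
  have hlen₁ := h₁.length_eq
  have hlen : (E₁ ++ rk :: E₂).length - 1 - F₁.length = G₂.length := by
    have := hG₂.length_eq
    have := h₂.length_eq
    simp at *
    omega
  have hset : Rep 0 1 (G₂ ++ ⟨rk.A, 1 / 2, 0, s⟩ :: G₁)
      ((F₂.map SRow.adual).reverse ++
        ⟨K, 0, U * s * (K + 1)⟩ :: (F₁.map SRow.adual).reverse.map (mirror 0)) := by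
    refine hG₂.append (.cons ⟨hA, by simp, hK, hs', 0, by simp, by dsimp only; omega, ?_⟩ ?_)
    · simp [hU]
    · have := hG₃.neg
      rw [sg_succ] at this
      simpa [hU] using this
  have hdd := hset.dual fun m hm => by
    have hab := h.b_le_a
    simp only [List.mem_append, List.mem_cons, List.mem_reverse, List.mem_map] at hm hab
    rcases hm with ⟨n, hn, rfl⟩ | rfl | ⟨_, ⟨n, hn, rfl⟩, rfl⟩
    · have := hab n (.inr (.inr hn))
      simp only [SRow.adual]; omega
    · dsimp only; omega
    · have := hab n (.inl hn)
      simp only [SRow.adual, mirror]; omega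
  have hlist : (((F₂.map SRow.adual).reverse ++ (⟨K, 0, U * s * (K + 1)⟩ : SRow) ::
      (F₁.map SRow.adual).reverse.map (mirror 0)).map SRow.adual).reverse =
      F₁.map (mirror 2) ++ (⟨K, -1, 1 - U * s * (K + 1)⟩ :: F₂) := by
    simp only [List.map_append, List.map_cons, List.map_reverse, List.reverse_append,
      List.reverse_cons, List.reverse_reverse, List.map_map, List.append_assoc,
      List.singleton_append]
    congr 1
    · refine List.map_congr_left fun m _ => ?_
      ext <;> simp [SRow.adual, mirror]; ring
    · congr 1
      exact (List.map_congr_left fun m _ => adual_adual m).trans (List.map_id _)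
  rw [hlist] at hdd
  obtain ⟨D₁, D₂, hD, hD₁, -⟩ := hdd.exists_append
  have hDlen : D₁.length = F₁.length := by simpa using hD₁.length_eq
  have hplus : LocalArthur.dualPlus F₁.length (E₁ ++ rk :: E₂) =
      D₁ ++ ⟨rk.A, -(1 / 2), 0, -rk.eta⟩ :: E₂ := by
    have hget : (E₁ ++ rk :: E₂)[F₁.length]? = some rk := by simp [← hlen₁]
    simp only [LocalArthur.dualPlus, hget, hlen, ← hs, hG]
    rw [List.set_append_right _ _ le_rfl, Nat.sub_self, List.set_cons_zero, hD, ← hDlen,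
      List.take_left, hDlen, ← hlen₁]
    simp
  rw [hplus]
  refine hD₁.append (.cons ⟨hA, by norm_num, by dsimp only; omega, ?_, 0, by simp,
    by dsimp only; omega, ?_⟩ ?_)
  · rcases he with he | he <;> simp [he]
  · rw [one_mul, tw_map_mirror, mul_neg, hl₀.2]; simp; ring
  · have := h₂.neg
    rw [← mul_neg, ← sg_succ] at this
    simpa using this

/-! ### The partial dual -/

theorem Rep.dualPlusApplicable {K : ℤ} {E : List Row} {F₁ F₂ : List SRow}
    (h : Rep 0 1 E (F₁ ++ ⟨K, 0, -(K + 1)⟩ :: F₂)) (hF₁ : ∀ m ∈ F₁, m.b < 0) :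
    DualPlusApplicable E F₁.length := by
  obtain ⟨E₁, E₂, rfl, h₁, h₂⟩ := h.exists_append
  rw [one_mul] at h₂
  cases h₂ with
  | @cons _ r _ E₂ _ h₂ _ =>
    have hlen := h₁.length_eq
    obtain ⟨hA, hB, hK, he, l, hl, hl', hd⟩ := h₂
    dsimp only at hB hK hl' hd
    have hl₀ : l = 0 ∧ r.eta = -tw F₁ := by
      rcases tw_eq F₁ with ht | ht <;> rcases he with he | he <;> rw [ht, he] at hd ⊢ <;> omega
    refine ⟨r, by simp [← hlen], by simpa using hB, by simp [hl, hl₀.1], ?_, fun i hi s hs => ?_⟩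
    · rw [← hlen, alphaAt_append, h₁.m1pow_sum_a, hl₀.2]
    · rw [List.getElem?_append_left (by omega)] at hs
      obtain ⟨m, hm, _, _, h₃⟩ := h₁.exists_mem (.inl rfl) (List.mem_of_getElem? hs)
      exact (lt_iff_of_sub_eq (n := 0) (by rw [h₃.2.1]; push_cast; ring)).2 (hF₁ m hm)

theorem DualPlusApplicable.exists_rep {E : List Row} {k : ℕ} (hk : DualPlusApplicable E k)
    (hE : IsEMS E) (hP : Pprime E) :
    ∃ K F₁ F₂, Rep 0 1 E (F₁ ++ ⟨K, 0, -(K + 1)⟩ :: F₂) ∧ F₁.length = k ∧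
      (∀ m ∈ F₁, m.b < 0) ∧ ∀ m ∈ F₂, 0 ≤ m.b := by
  obtain ⟨r, hr, hB, hl, he, hlt⟩ := hk
  have hmem := List.mem_of_getElem? hr
  obtain ⟨n, hn⟩ := (hE.1.1 r hmem).2.2.1
  obtain ⟨F, hF⟩ := Rep.exists_of_isES 1 (E := E) fun s hs => by
    obtain ⟨j, hj⟩ := isInt_iff.1 (hE.1.2.2.1 s hs r hmem)
    exact ⟨hE.1.1 s hs, (hE.2 s hs).2, j + n, by push_cast; linarith⟩
  have hPF := (hF.pprime_iff (.inl rfl)).1 hP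
  obtain ⟨E₁, E₂, rfl, rfl⟩ := eq_append_of_getElem? hr
  obtain ⟨F₁, F₂, rfl, h₁, h₂⟩ := hF.exists_append_left
  rw [one_mul] at h₂
  rw [alphaAt_append, h₁.m1pow_sum_a] at he
  cases h₂ with
  | @cons _ _ m _ F₂ h₂ _ =>
    obtain ⟨hA, hB', hK, -, l, hl', -, hd⟩ := h₂
    have hb : m.b = 0 := by
      have : (m.b : ℚ) = 0 := by rw [hB] at hB'; push_cast at hB'; linarith
      exact_mod_cast this
    have hl₀ : l = 0 := by
      rw [hl] at hl'
      exact_mod_cast hl'.symm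
    have hm : m = ⟨m.a, 0, -(m.a + 1)⟩ := by
      ext
      · rfl
      · exact hb
      · rw [hd, he, hb, hl₀]
        rcases tw_eq F₁ with h | h <;> rw [h] <;> ring
    refine ⟨m.a, F₁, F₂, hm ▸ hF, h₁.length_eq.symm, fun n hn => ?_, fun n hn => ?_⟩
    · obtain ⟨s, hs, _, _, h₃⟩ := h₁.exists_mem_right (.inl rfl) hn
      obtain ⟨i, hi, rfl⟩ := List.getElem_of_mem hs
      have := hlt i hi _ (by rw [List.getElem?_append_left hi, List.getElem?_eq_getElem hi])
      exact (lt_iff_of_sub_eq (n := 0) (by rw [h₃.2.1]; push_cast; ring)).1 this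
    · rw [← hb]
      exact (List.pairwise_cons.1 (List.pairwise_append.1 hPF).2.1).1 n hn

theorem pairwise_pdual {K : ℤ} {F₁ F₂ : List SRow}
    (hP : (F₁ ++ ⟨K, 0, -(K + 1)⟩ :: F₂).Pairwise fun m n => m.b ≤ n.b)
    (h₁ : ∀ m ∈ F₁, m.b < 0) : (pdual K F₁ F₂).Pairwise fun m n => m.b ≤ n.b := by
  rw [List.pairwise_append, List.pairwise_cons] at hP
  obtain ⟨hP₁, ⟨hP₂, hP₃⟩, hP₄⟩ := hP
  rw [pdual, List.pairwise_append, List.pairwise_cons, List.pairwise_map, List.pairwise_map]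
  refine ⟨hP₁, ⟨fun m hm => ?_, hP₃⟩, fun m hm n hn => ?_⟩
  · obtain ⟨n, hn, rfl⟩ := List.mem_map.1 hm
    have := hP₂ n hn
    simp only [mirror] at *
    omega
  · obtain ⟨m, hm', rfl⟩ := List.mem_map.1 hm
    have := h₁ m hm'
    rcases List.mem_cons.1 hn with rfl | hn
    · simp only [mirror]; omega
    · obtain ⟨n, hn', rfl⟩ := List.mem_map.1 hn
      exact hP₄ m hm' n (List.mem_cons_of_mem _ hn')

theorem Adm.of_pairwise {F : List SRow} (h : F.Pairwise fun m n => m.b ≤ n.b) : Adm F :=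
  h.imp fun h hp => by have := hp.2; omega

theorem map_adual_pdual_reverse (K : ℤ) (F₁ F₂ : List SRow) :
    ((pdual K F₁ F₂).map SRow.adual).reverse =
      ((F₂.map (mirror 0)).map SRow.adual).reverse ++ ⟨K, 0, -(K + 1)⟩ ::
        ((F₁.map (mirror 2)).map SRow.adual).reverse := by
  simp only [pdual, List.map_append, List.map_cons, List.reverse_append, List.reverse_cons,
    List.append_assoc, List.singleton_append]
  congr 2
  ext <;> simp [SRow.adual]; ring

theorem map_adual_pdual_dual_reverse (K : ℤ) (F₁ F₂ : List SRow) :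
    ((pdual K ((F₂.map (mirror 0)).map SRow.adual).reverse
      ((F₁.map (mirror 2)).map SRow.adual).reverse).map SRow.adual).reverse =
      F₁ ++ ⟨K, 0, -(K + 1)⟩ :: F₂ := by
  rw [map_adual_pdual_reverse]
  simp only [List.map_reverse, List.reverse_reverse, List.map_map]
  congr 1
  · refine (List.map_congr_left fun m _ => ?_).trans (List.map_id _)
    ext <;> simp only [SRow.adual, mirror, Function.comp_apply, id] <;> ring
  · congr 1
    refine (List.map_congr_left fun m _ => ?_).trans (List.map_id _)
    ext <;> simp only [SRow.adual, mirror, Function.comp_apply, id] <;> ring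

/-- Theorem 6.8 (final assertions): if `dual_k^+` is applicable on `E`, then
`dual_k^+(E)` is a non-vanishing extended multi-segment datum on which `dual_k^-` is
applicable, and `dual_k^-(dual_k^+(E)) = E`. -/
theorem partial_dual_involutive (E : List Row)
    (hE : IsEMS E) (hNV : NonVanishing E) (hP : Pprime E)
    (k : ℕ) (hk : DualPlusApplicable E k) :
    IsEMS (dualPlus k E) ∧ NonVanishing (dualPlus k E) ∧
    DualMinusApplicable (dualPlus k E) k ∧
    SymEquiv (dualMinus k (dualPlus k E)) E := by
  obtain ⟨K, F₁, F₂, hF, rfl, hF₁, hF₂⟩ := hk.exists_rep hE hP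
  have hone : (1 : ℤ) = 1 ∨ (1 : ℤ) = -1 := .inl rfl
  have hbd := hF.bounds_of_isEMS hone hE
  have hstar := (hF.starCond_iff fun m hm => (hbd m hm).1).1 hNV.1
  have hsort := (hF.pprime_iff hone).1 hP
  have hLip := (hF.xuAll_reorder_iff hone (.of_pairwise hsort)).1 hNV.2
  have hD := hF.dualPlus fun m hm => (hbd m hm).1
  have hAdm := Adm.of_pairwise (pairwise_pdual hsort hF₁)
  have hab := hF.b_le_a
  simp only [List.forall_mem_append, List.forall_mem_cons] at hbd hstar hab
  obtain ⟨hbd₁, hbdK, hbd₂⟩ := hbd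
  obtain ⟨hstar₁, -, hstar₂⟩ := hstar
  obtain ⟨hab₁, habK, hab₂⟩ := hab
  have hbd' : ∀ m ∈ pdual K F₁ F₂, 0 ≤ m.a + m.b + 1 ∧ (m.d.natAbs : ℤ) ≤ m.a - m.b + 1 := by
    simp only [pdual, List.forall_mem_append, List.forall_mem_cons, List.forall_mem_map, mirror]
    refine ⟨fun m hm => ?_, ?_, fun m hm => ?_⟩
    · have := hbd₁ m hm
      have := hstar₁ m hm
      have := hF₁ m hm
      omega
    · omega
    · have := hbd₂ m hm
      omega
  have hD' := hD.dual fun m hm => (hbd' m hm).1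
  rw [map_adual_pdual_reverse] at hD'
  have hlen : (dualPlus F₁.length E).length - 1 - F₁.length =
      ((F₂.map (mirror 0)).map SRow.adual).reverse.length := by
    rw [hD.length_eq]
    simp [pdual]
  refine ⟨hD.isEMS hone hAdm hbd', ⟨(hD.starCond_iff fun m hm => (hbd' m hm).1).2 ?_,
    (hD.xuAll_reorder_iff hone hAdm).2 (hLip.pdual (fun m hm => ?_) hF₂ hAdm)⟩, ?_, ?_⟩
  · simp only [pdual, List.forall_mem_append, List.forall_mem_cons, List.forall_mem_map, mirror]
    refine ⟨fun m hm => ?_, ?_, fun m hm => ?_⟩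
    · have := hstar₁ m hm
      omega
    · omega
    · have := hbd₂ m hm
      have := hF₂ m hm
      omega
  · have := hstar₁ m hm
    have := hF₁ m hm
    omega
  · rw [DualMinusApplicable, hlen]
    refine hD'.dualPlusApplicable fun m hm => ?_
    simp only [List.mem_reverse, List.mem_map] at hm
    obtain ⟨_, ⟨n, hn, rfl⟩, rfl⟩ := hm
    have := hF₂ n hn
    simp only [SRow.adual, mirror]
    omega
  · have hD'' := hD'.dualPlus <| by
      simp only [List.forall_mem_append, List.forall_mem_cons, List.mem_reverse,
        List.forall_mem_map, SRow.adual, mirror]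
      refine ⟨fun m hm => ?_, by omega, fun m hm => ?_⟩
      · have := hab₂ m hm
        omega
      · have := hab₁ m hm
        omega
    have hD₃ := hD''.dual <| by
      simp only [pdual, List.forall_mem_append, List.forall_mem_cons, List.mem_reverse,
        List.forall_mem_map, SRow.adual, mirror]
      refine ⟨fun m hm => ?_, by omega, fun m hm => ?_⟩
      · have := hab₂ m hm
        omega
      · have := hab₁ m hm
        omega
    rw [map_adual_pdual_dual_reverse] at hD₃
    rw [dualMinus, hlen]
    exact hD₃.symEquiv hone hF

end LocalArthur
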